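/- arXiv:2312.01803 — 2 statements merged into one kernel-verified Lean document; each statement's English description precedes it below -/
import Mathlib

section
/- Let (Γ,K,π) be a Markov kernel with K periodic (necessarily of period 2, with two periodicity classes A and A^c). Then for every x,y ∈ V the series 𝒢(x,y) = Σ_{n=0}^∞ (k^{2n}(x,y) + k^{2n+1}(x,y) − 2) converges, and the expected hitting time satisfies: H(x,y) = 𝒢(y,y) − 𝒢(x,y) if x and y lie in the same periodicity class, and H(x,y) = 1 + 𝒢(y,y) − 𝒢(x,y) if x and y lie in different periodicity classes. -/
open Finset
open scoped Classical

variable {V : Type*} [Fintype V] [DecidableEq V]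

/-- `matpow K n` is the `n`-th matrix power of the kernel `K`. -/
noncomputable def matpow (K : V → V → ℝ) : ℕ → V → V → ℝ
  | 0 => fun x y => if x = y then (1 : ℝ) else 0
  | n + 1 => fun x y => ∑ z, K x z * matpow K n z y

/-- `(Γ, K, π)` is a Markov kernel: `G` is a connected (simple) graph on the finite vertex
set `V`, `K` is a stochastic kernel, irreducible, reversible with respect to the probability
measure `pi`, positive on edges and vanishing off edges (apart from the diagonal). -/
def IsMarkovKernel (G : SimpleGraph V) (K : V → V → ℝ) (pi : V → ℝ) : Prop :=
  G.Connected ∧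
  (∀ x y, 0 ≤ K x y) ∧ (∀ x, ∑ y, K x y = 1) ∧
  (∀ x, 0 < pi x) ∧ (∑ x, pi x = 1) ∧
  (∀ x y, pi x * K x y = pi y * K y x) ∧
  (∀ x y, G.Adj x y → 0 < K x y) ∧
  (∀ x y, x ≠ y → ¬ G.Adj x y → K x y = 0) ∧
  (∀ x y, ∃ n, 0 < matpow K n x y)

/-- Aperiodicity of an irreducible finite kernel, via primitivity. -/
def Aperiodic (K : V → V → ℝ) : Prop :=
  ∃ N : ℕ, ∀ n ≥ N, ∀ x y, 0 < matpow K n x y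

/-- `K` is lazy if `K(x,x) ≥ 1/2` for all `x`. -/
def Lazy (K : V → V → ℝ) : Prop := ∀ x, (1 : ℝ) / 2 ≤ K x x

/-- The closed ball `B(x,r)` for the graph distance. -/
noncomputable def gball (G : SimpleGraph V) (x : V) (r : ℝ) : Finset V :=
  univ.filter fun y => (G.dist x y : ℝ) ≤ r

/-- The volume `V(x,r) = π(B(x,r))`. -/
noncomputable def vol (G : SimpleGraph V) (pi : V → ℝ) (x : V) (r : ℝ) : ℝ :=
  ∑ y ∈ gball G x r, pi y

/-- The diameter of the graph `G`. -/
noncomputable def gdiam (G : SimpleGraph V) : ℕ :=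
  univ.sup fun x => univ.sup fun y => G.dist x y

/-- The normalized kernel `k^n(x,y) = K^n(x,y)/π(y)`. -/
noncomputable def knorm (K : V → V → ℝ) (pi : V → ℝ) (n : ℕ) (x y : V) : ℝ :=
  matpow K n x y / pi y

/-- The normalized Green function `𝒢(x,y) = ∑_{n≥0} (k^n(x,y) - 1)`. -/
noncomputable def green (K : V → V → ℝ) (pi : V → ℝ) (x y : V) : ℝ :=
  ∑' n : ℕ, (knorm K pi n x y - 1)

/-- `avoid K y n x = P_x(X_0 ≠ y, …, X_n ≠ y) = P_x(τ_y > n)`. -/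
noncomputable def avoid (K : V → V → ℝ) (y : V) : ℕ → V → ℝ
  | 0 => fun x => if x = y then 0 else 1
  | n + 1 => fun x => if x = y then 0 else ∑ z, K x z * avoid K y n z

/-- The expected hitting time `H(x,y) = E_x[τ_y] = ∑_{n≥0} P_x(τ_y > n)`. -/
noncomputable def hit (K : V → V → ℝ) (x y : V) : ℝ := ∑' n : ℕ, avoid K y n x

/-- `P_x(d(x, X_s) > R)` for the chain driven by `K` started at `x`. -/
noncomputable def probGt (G : SimpleGraph V) (K : V → V → ℝ) (x : V) (s : ℕ) (R : ℝ) : ℝ :=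
  ∑ y ∈ univ.filter (fun y => R < (G.dist x y : ℝ)), matpow K s x y

/-- The probability that the chain driven by `K`, started at `x`, produces a trajectory
`(X_0, …, X_t)` belonging to the event `A`. -/
noncomputable def pathProb (K : V → V → ℝ) (x : V) (t : ℕ)
    (A : (Fin (t + 1) → V) → Prop) : ℝ :=
  ∑ p ∈ univ.filter (fun p : Fin (t + 1) → V => p 0 = x ∧ A p),
    ∏ i : Fin t, K (p i.castSucc) (p i.succ)

/-- Condition (E): ellipticity with constant `p0`. -/
def CondE (G : SimpleGraph V) (K : V → V → ℝ) (p0 : ℝ) : Prop :=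
  ∀ x y, G.Adj x y → p0 ≤ K x y

/-- Condition (VD): volume doubling with constant `CD`. -/
def CondVD (G : SimpleGraph V) (pi : V → ℝ) (CD : ℝ) : Prop :=
  ∀ x : V, ∀ r : ℝ, 0 < r → vol G pi x (2 * r) ≤ CD * vol G pi x r

/-- The `π`-average of `f` over the ball `B(x,r)`. -/
noncomputable def ballAvg (G : SimpleGraph V) (pi : V → ℝ) (x : V) (r : ℝ) (f : V → ℝ) : ℝ :=
  (vol G pi x r)⁻¹ * ∑ z ∈ gball G x r, f z * pi z

/-- Condition (PI(θ)): Poincaré inequality with constant `CP`. -/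
def CondPI (G : SimpleGraph V) (K : V → V → ℝ) (pi : V → ℝ) (θ CP : ℝ) : Prop :=
  ∀ x : V, ∀ r : ℝ, 0 < r → ∀ f : V → ℝ,
    (∑ z ∈ gball G x r, |f z - ballAvg G pi x r f| ^ 2 * pi z) ≤
      CP * r ^ θ * ∑ ξ ∈ gball G x r, ∑ ζ ∈ gball G x r,
        if G.Adj ξ ζ then |f ξ - f ζ| ^ 2 * K ξ ζ * pi ξ else 0

/-- Condition (CS(θ)): existence of cut-off functions. -/
def CondCS (G : SimpleGraph V) (K : V → V → ℝ) (pi : V → ℝ) (θ C1 C2 ε : ℝ) : Prop :=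
  ∀ x : V, ∀ r : ℝ, 0 < r → ∃ σ : V → ℝ,
    (∀ y ∈ gball G x (r / 2), 1 ≤ σ y) ∧
    (∀ y, y ∉ gball G x r → σ y = 0) ∧
    (∀ z y, |σ z - σ y| ≤ C1 * ((G.dist z y : ℝ) / r) ^ ε) ∧
    (∀ s : ℝ, 0 < s → s ≤ r → ∀ f : V → ℝ,
      (∑ z ∈ gball G x s, |f z| ^ 2 *
          ∑ y, (if G.Adj z y then |σ z - σ y| ^ 2 * K z y * pi z else 0)) ≤
        C2 * (s / r) ^ (2 * ε) *
          ((∑ z ∈ gball G x (2 * s), ∑ y ∈ gball G x (2 * s),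
              if G.Adj z y then |f z - f y| ^ 2 * K z y * pi z else 0) +
            s ^ (-θ) * ∑ z ∈ gball G x (2 * s), |f z| ^ 2 * pi z))

/-- The Harnack assumptions (E), (VD), (PI(θ)), (CS(θ)) with the given constants. -/
def Harnack (G : SimpleGraph V) (K : V → V → ℝ) (pi : V → ℝ)
    (θ p0 CD CP Ccs1 Ccs2 ε : ℝ) : Prop :=
  0 < p0 ∧ 0 < CD ∧ 0 < CP ∧ 0 < Ccs1 ∧ 0 < Ccs2 ∧ 0 < ε ∧
  CondE G K p0 ∧ CondVD G pi CD ∧ CondPI G K pi θ CP ∧ CondCS G K pi θ Ccs1 Ccs2 ε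

/-- The Green function of a periodic (period two) chain:
`𝒢(x,y) = ∑_{n≥0} (k^{2n}(x,y) + k^{2n+1}(x,y) − 2)`. -/
noncomputable def greenPer (K : V → V → ℝ) (pi : V → ℝ) (x y : V) : ℝ :=
  ∑' n : ℕ, (knorm K pi (2 * n) x y + knorm K pi (2 * n + 1) x y - 2)

/-- The remainder kernel. -/
noncomputable def rr (K : V → V → ℝ) (pi s : V → ℝ) (n : ℕ) (x y : V) : ℝ :=
  knorm K pi n x y - 1 - (-1) ^ n * s x * s y

/-- The action of the `n`-th power on functions. -/
noncomputable def PP (K : V → V → ℝ) (n : ℕ) (f : V → ℝ) (x : V) : ℝ :=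
  ∑ z, matpow K n x z * f z

theorem aux_adj (K : V → V → ℝ) (pi : V → ℝ) (hrev : ∀ x y, pi x * K x y = pi y * K y x)
    (f g : V → ℝ) :
    ∑ x, pi x * f x * ∑ z, K x z * g z = ∑ z, pi z * (∑ x, K z x * f x) * g z := by
  simp only [Finset.mul_sum, Finset.sum_mul]
  rw [Finset.sum_comm]
  refine Finset.sum_congr rfl fun z _ => Finset.sum_congr rfl fun x _ => ?_
  linear_combination f x * g z * hrev x z

theorem aux_Ks (K : V → V → ℝ) (s : V → ℝ) (hsum : ∀ x, ∑ y, K x y = 1)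
    (hs : ∀ x y, K x y * (s x + s y) = 0) (x : V) : ∑ z, K x z * s z = - s x := by
  have : ∑ z, K x z * s z = ∑ z, -(K x z * s x) :=
    Finset.sum_congr rfl fun z _ => by linear_combination hs x z
  rw [this, Finset.sum_neg_distrib, ← Finset.sum_mul, hsum, one_mul]

theorem aux_pis (K : V → V → ℝ) (pi s : V → ℝ) (hsum : ∀ x, ∑ y, K x y = 1)
    (hrev : ∀ x y, pi x * K x y = pi y * K y x)
    (hs : ∀ x y, K x y * (s x + s y) = 0) : ∑ z, pi z * s z = 0 := by
  have h := aux_adj K pi hrev (fun _ => 1) s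
  simp only [mul_one, hsum, aux_Ks K s hsum hs, mul_neg, Finset.sum_neg_distrib] at h
  linarith

theorem aux_knorm_succ (K : V → V → ℝ) (pi : V → ℝ) (n : ℕ) (x y : V) :
    knorm K pi (n + 1) x y = ∑ z, K x z * knorm K pi n z y := by
  simp only [knorm, matpow, Finset.sum_div, mul_div_assoc]

theorem aux_rr_succ (K : V → V → ℝ) (pi s : V → ℝ) (hsum : ∀ x, ∑ y, K x y = 1)
    (hs : ∀ x y, K x y * (s x + s y) = 0) (n : ℕ) (x y : V) :
    rr K pi s (n + 1) x y = ∑ z, K x z * rr K pi s n z y := by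
  have h1 := aux_Ks K s hsum hs x
  have h2 : ∑ z, K x z * rr K pi s n z y
      = ∑ z, K x z * knorm K pi n z y - ∑ z, K x z - (-1) ^ n * s y * ∑ z, K x z * s z := by
    rw [Finset.mul_sum, ← Finset.sum_sub_distrib, ← Finset.sum_sub_distrib]
    refine Finset.sum_congr rfl fun z _ => ?_
    simp only [rr]; ring
  rw [h2, h1, hsum, ← aux_knorm_succ]
  simp only [rr, pow_succ]; ring

theorem aux_delta (pi : V → ℝ) (hpi : ∀ x, 0 < pi x) (K : V → V → ℝ) (f : V → ℝ) (y : V) :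
    ∑ z, pi z * f z * knorm K pi 0 z y = f y := by
  have := (hpi y).ne'
  simp only [knorm, matpow]
  rw [Finset.sum_eq_single y]
  · simp; field_simp
  · intro b _ hb; simp [hb]
  · simp

theorem aux_orth (K : V → V → ℝ) (pi s : V → ℝ) (hsum : ∀ x, ∑ y, K x y = 1)
    (hpi : ∀ x, 0 < pi x) (hp1 : ∑ x, pi x = 1)
    (hrev : ∀ x y, pi x * K x y = pi y * K y x)
    (hs : ∀ x y, K x y * (s x + s y) = 0) (hs2 : ∀ x, s x * s x = 1) (n : ℕ) (y : V) :
    ∑ z, pi z * rr K pi s n z y = 0 ∧ ∑ z, pi z * s z * rr K pi s n z y = 0 := by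
  have hps := aux_pis K pi s hsum hrev hs
  induction n with
  | zero =>
    constructor
    · have h := aux_delta pi hpi K (fun _ => 1) y
      have h2 : ∑ z, pi z * rr K pi s 0 z y
        = ∑ z, pi z * 1 * knorm K pi 0 z y - ∑ z, pi z - s y * ∑ z, pi z * s z := by
        rw [Finset.mul_sum, ← Finset.sum_sub_distrib, ← Finset.sum_sub_distrib]
        refine Finset.sum_congr rfl fun z _ => ?_
        simp only [rr]; ring
      rw [h2, h, hp1, hps]; ring
    · have h := aux_delta pi hpi K s y
      have h2 : ∑ z, pi z * s z * rr K pi s 0 z y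
        = ∑ z, pi z * s z * knorm K pi 0 z y - ∑ z, pi z * s z - s y * ∑ z, pi z := by
        rw [Finset.mul_sum, ← Finset.sum_sub_distrib, ← Finset.sum_sub_distrib]
        refine Finset.sum_congr rfl fun z _ => ?_
        simp only [rr]; linear_combination (- pi z * s y) * hs2 z
      rw [h2, h, hp1, hps]; ring
  | succ n ih =>
    simp only [aux_rr_succ K pi s hsum hs]
    constructor
    · have h := aux_adj K pi hrev (fun _ => 1) (fun z => rr K pi s n z y)
      simp only [mul_one, hsum] at h
      rw [h]; exact ih.1
    · have h := aux_adj K pi hrev s (fun z => rr K pi s n z y)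
      rw [h]
      simp only [aux_Ks K s hsum hs, mul_neg, neg_mul, Finset.sum_neg_distrib]
      rw [ih.2, neg_zero]

theorem aux_conv (K : V → V → ℝ) (pi s : V → ℝ) (hsum : ∀ x, ∑ y, K x y = 1)
    (hpi : ∀ x, 0 < pi x) (hp1 : ∑ x, pi x = 1)
    (hrev : ∀ x y, pi x * K x y = pi y * K y x)
    (hs : ∀ x y, K x y * (s x + s y) = 0) (hs2 : ∀ x, s x * s x = 1) (m n : ℕ) (x y : V) :
    rr K pi s (m + n) x y = ∑ z, pi z * rr K pi s m x z * rr K pi s n z y := by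
  induction m generalizing x with
  | zero =>
    obtain ⟨h1, h2⟩ := aux_orth K pi s hsum hpi hp1 hrev hs hs2 n y
    have h3 : ∑ z, pi z * rr K pi s 0 x z * rr K pi s n z y
        = ∑ z, pi z * knorm K pi 0 x z * rr K pi s n z y - ∑ z, pi z * rr K pi s n z y
          - s x * ∑ z, pi z * s z * rr K pi s n z y := by
      rw [Finset.mul_sum, ← Finset.sum_sub_distrib, ← Finset.sum_sub_distrib]
      refine Finset.sum_congr rfl fun z _ => ?_
      rw [show rr K pi s 0 x z = knorm K pi 0 x z - 1 - (-1) ^ 0 * s x * s z from rfl]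
      ring
    have h4 : ∑ z, pi z * knorm K pi 0 x z * rr K pi s n z y = rr K pi s n x y := by
      have := (hpi x).ne'
      rw [Finset.sum_eq_single x]
      · simp [knorm, matpow, this]
      · intro b _ hb; simp [knorm, matpow, Ne.symm hb]
      · simp
    rw [h3, h4, h1, h2]; simp
  | succ m ih =>
    rw [show m + 1 + n = (m + n) + 1 by ring, aux_rr_succ K pi s hsum hs]
    simp only [ih, aux_rr_succ K pi s hsum hs m, Finset.mul_sum, Finset.sum_mul]
    rw [Finset.sum_comm]
    refine Finset.sum_congr rfl fun z _ => Finset.sum_congr rfl fun w _ => ?_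
    ring

theorem aux_rr_one (K : V → V → ℝ) (pi s : V → ℝ) (hpi : ∀ x, 0 < pi x)
    (hrev : ∀ x y, pi x * K x y = pi y * K y x) (x y : V) :
    rr K pi s 1 x y = rr K pi s 1 y x := by
  have hx := (hpi x).ne'
  have hy := (hpi y).ne'
  have h1 : K x y / pi y = K y x / pi x := by
    field_simp; linear_combination hrev x y
  simp [rr, knorm, matpow]
  rw [h1]; ring

theorem aux_symm (K : V → V → ℝ) (pi s : V → ℝ) (hsum : ∀ x, ∑ y, K x y = 1)
    (hpi : ∀ x, 0 < pi x) (hp1 : ∑ x, pi x = 1)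
    (hrev : ∀ x y, pi x * K x y = pi y * K y x)
    (hs : ∀ x y, K x y * (s x + s y) = 0) (hs2 : ∀ x, s x * s x = 1) (n : ℕ) (x y : V) :
    rr K pi s n x y = rr K pi s n y x := by
  induction n generalizing x y with
  | zero =>
    by_cases h : x = y
    · rw [h]
    · simp [rr, knorm, matpow, h, Ne.symm h]; ring
  | succ n ih =>
    rw [aux_conv K pi s hsum hpi hp1 hrev hs hs2 n 1 y x, add_comm n 1,
      aux_conv K pi s hsum hpi hp1 hrev hs hs2 1 n x y]
    refine Finset.sum_congr rfl fun z _ => ?_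
    rw [ih z y, aux_rr_one K pi s hpi hrev x z]; ring

theorem aux_even (K : V → V → ℝ) (pi s : V → ℝ) (hsum : ∀ x, ∑ y, K x y = 1)
    (hpi : ∀ x, 0 < pi x) (hp1 : ∑ x, pi x = 1)
    (hrev : ∀ x y, pi x * K x y = pi y * K y x)
    (hs : ∀ x y, K x y * (s x + s y) = 0) (hs2 : ∀ x, s x * s x = 1) (n : ℕ) (x y : V) :
    0 ≤ rr K pi s (2 * n) x x ∧
    |rr K pi s (2 * n) x y| ≤ rr K pi s (2 * n) x x + rr K pi s (2 * n) y y := by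
  have hd : ∀ x y, rr K pi s (2 * n) x y
      = ∑ z, pi z * rr K pi s n x z * rr K pi s n y z := fun x y => by
    rw [two_mul, aux_conv K pi s hsum hpi hp1 hrev hs hs2]
    refine Finset.sum_congr rfl fun z _ => ?_
    rw [aux_symm K pi s hsum hpi hp1 hrev hs hs2 n z y]
  constructor
  · rw [hd]
    refine Finset.sum_nonneg fun z _ => ?_
    have := mul_nonneg (hpi z).le (mul_self_nonneg (rr K pi s n x z))
    linarith
  · rw [hd, hd, hd, ← Finset.sum_add_distrib]
    refine (Finset.abs_sum_le_sum_abs _ _).trans (Finset.sum_le_sum fun z _ => ?_)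
    have hp := (hpi z).le
    generalize rr K pi s n x z = a
    generalize rr K pi s n y z = b
    rw [abs_le]
    constructor
    · nlinarith [mul_nonneg hp (sq_nonneg (a + b)), mul_nonneg hp (sq_nonneg a),
        mul_nonneg hp (sq_nonneg b)]
    · nlinarith [mul_nonneg hp (sq_nonneg (a - b)), mul_nonneg hp (sq_nonneg a),
        mul_nonneg hp (sq_nonneg b)]

theorem aux_par (K : V → V → ℝ) (s : V → ℝ)
    (hs : ∀ x y, K x y * (s x + s y) = 0) (n : ℕ) (x y : V) :
    matpow K n x y * s y = (-1) ^ n * s x * matpow K n x y := by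
  induction n generalizing x with
  | zero =>
    by_cases h : x = y <;> simp [matpow, h]
  | succ n ih =>
    simp only [matpow, Finset.sum_mul, Finset.mul_sum]
    refine Finset.sum_congr rfl fun z _ => ?_
    rw [pow_succ]
    linear_combination K x z * ih z + (-1) ^ n * matpow K n z y * hs x z

theorem aux_odd (K : V → V → ℝ) (pi s : V → ℝ)
    (hs : ∀ x y, K x y * (s x + s y) = 0) (hs2 : ∀ x, s x * s x = 1) (n : ℕ) (x : V) :
    rr K pi s (2 * n + 1) x x = 0 := by
  have h := aux_par K s hs (2 * n + 1) x x
  have e : (-1 : ℝ) ^ (2 * n + 1) = -1 := by rw [pow_succ, pow_mul]; simp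
  rw [e] at h
  have h0 : matpow K (2 * n + 1) x x = 0 := by
    linear_combination (s x / 2) * h - matpow K (2 * n + 1) x x * hs2 x
  rw [rr, knorm, h0, e]
  linear_combination hs2 x

theorem aux_term (K : V → V → ℝ) (pi s : V → ℝ) (n : ℕ) (x y : V) :
    knorm K pi (2 * n) x y + knorm K pi (2 * n + 1) x y - 2
      = rr K pi s (2 * n) x y + rr K pi s (2 * n + 1) x y := by
  simp only [rr, pow_succ]; ring

theorem aux_avoid (K : V → V → ℝ) (hK : ∀ x y, 0 ≤ K x y) (hsum : ∀ x, ∑ y, K x y = 1)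
    (y : V) (n : ℕ) (x : V) : 0 ≤ avoid K y n x ∧ avoid K y n x ≤ 1 := by
  induction n generalizing x with
  | zero => by_cases h : x = y <;> simp [avoid, h]
  | succ n ih =>
    by_cases h : x = y
    · simp [avoid, h]
    · simp only [avoid, h, if_false]
      refine ⟨Finset.sum_nonneg fun z _ => mul_nonneg (hK x z) (ih z).1, ?_⟩
      rw [← hsum x]
      exact Finset.sum_le_sum fun z _ => mul_le_of_le_one_right (hK x z) (ih z).2

theorem aux_avoid_self (K : V → V → ℝ) (y : V) (n : ℕ) : avoid K y n y = 0 := by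
  cases n <;> simp [avoid]

theorem aux_S (K : V → V → ℝ) (y x : V) (h : x ≠ y) (N : ℕ) :
    (∑ n ∈ range N, avoid K y n x) + avoid K y N x
      = 1 + ∑ z, K x z * ∑ n ∈ range N, avoid K y n z := by
  rw [← Finset.sum_range_succ, Finset.sum_range_succ']
  simp only [Finset.mul_sum]
  rw [Finset.sum_comm, add_comm]
  simp [avoid, h]

theorem aux_summable (G : SimpleGraph V) (K : V → V → ℝ) (pi : V → ℝ)
    (hM : IsMarkovKernel G K pi) (x y : V) : Summable fun n => avoid K y n x := by
  obtain ⟨hG, hK, hsum, hpi, hp1, hrev, hadj, -, -⟩ := hM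
  have hav := aux_avoid K hK hsum y
  set S : ℕ → V → ℝ := fun N x => ∑ n ∈ range N, avoid K y n x with hS
  have hSnn : ∀ N x, 0 ≤ S N x := fun N x => Finset.sum_nonneg fun n _ => (hav n x).1
  have hSy : ∀ N, S N y = 0 := fun N => by simp [hS, aux_avoid_self]
  have hSK : ∀ N x, x ≠ y → S N x = 1 - avoid K y N x + ∑ z, K x z * S N z := fun N x h => by
    have := aux_S K y x h N
    simp only [hS]; linarith
  have hKy : ∀ N, pi y * ∑ z, K y z * S N z ≤ 1 := fun N => by
    have h1 := aux_adj K pi hrev (fun _ => 1) (S N)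
    simp only [mul_one, hsum] at h1
    have h2 : ∑ x, (pi x * (if x = y then ∑ z, K y z * S N z else 0) - pi x)
        ≤ ∑ x, (pi x * ∑ z, K x z * S N z - pi x * S N x) := by
      refine Finset.sum_le_sum fun x _ => ?_
      by_cases h : x = y
      · subst h
        simp only [if_true, hSy]
        linarith [hpi x]
      · simp only [h, if_false]
        have := hSK N x h
        have h4 := mul_nonneg (hpi x).le (hav N x).1
        rw [this]
        linarith
    rw [Finset.sum_sub_distrib, Finset.sum_sub_distrib, h1, sub_self, hp1] at h2
    simp at h2
    linarith
  have hstep : ∀ x z, G.Adj x z → (∃ C, ∀ N, S N x ≤ C) → ∃ C, ∀ N, S N z ≤ C := by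
    rintro x z hxz ⟨C, hC⟩
    have hk := hadj x z hxz
    have hle : ∀ N, K x z * S N z ≤ ∑ w, K x w * S N w := fun N =>
      Finset.single_le_sum (f := fun w => K x w * S N w)
        (fun w _ => mul_nonneg (hK x w) (hSnn N w)) (Finset.mem_univ z)
    by_cases h : x = y
    · subst h
      refine ⟨1 / pi x / K x z, fun N => ?_⟩
      rw [le_div_iff₀ hk, le_div_iff₀ (hpi x)]
      have := mul_le_mul_of_nonneg_left (hle N) (hpi x).le
      linarith [hKy N]
    · refine ⟨C / K x z, fun N => ?_⟩
      rw [le_div_iff₀ hk]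
      linarith [hle N, hC N, hSK N x h, (hav N x).2]
  have hall : ∃ C, ∀ N, S N x ≤ C := by
    obtain ⟨w⟩ := hG.preconnected y x
    have hw : ∀ {u v : V} (_ : G.Walk u v), (∃ C, ∀ N, S N u ≤ C) → ∃ C, ∀ N, S N v ≤ C := by
      intro u v w
      induction w with
      | nil => exact id
      | cons h _ ih => exact fun hu => ih (hstep _ _ h hu)
    exact hw w ⟨0, fun N => (hSy N).le⟩
  obtain ⟨C, hC⟩ := hall
  exact summable_of_sum_range_le (fun n => (hav n x).1) hC

theorem aux_hit (G : SimpleGraph V) (K : V → V → ℝ) (pi : V → ℝ)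
    (hM : IsMarkovKernel G K pi) (x y : V) :
    hit K x y - ∑ z, K x z * hit K z y = 1 - knorm K pi 0 x y := by
  have hsm := fun x => aux_summable G K pi hM x y
  obtain ⟨hG, hK, hsum, hpi, hp1, hrev, hadj, -, -⟩ := hM
  have hy0 : hit K y y = 0 := by simp [hit, aux_avoid_self]
  have hne : ∀ x, x ≠ y → hit K x y = 1 + ∑ z, K x z * hit K z y := by
    intro x h
    rw [hit, (hsm x).tsum_eq_zero_add]
    simp only [avoid, h, if_false]
    rw [Summable.tsum_finsetSum (fun z _ => (hsm z).mul_left (K x z))]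
    simp only [tsum_mul_left, hit]
  by_cases h : x = y
  · subst h
    have h1 := aux_adj K pi hrev (fun _ => 1) (fun z => hit K z x)
    simp only [mul_one, hsum] at h1
    have h2 : ∑ w, (pi w * ∑ z, K w z * hit K z x - pi w * hit K w x)
        = ∑ w, (pi w * (if w = x then 1 + ∑ z, K x z * hit K z x else 0) - pi w) := by
      refine Finset.sum_congr rfl fun w _ => ?_
      by_cases h : w = x
      · subst h
        simp only [if_true, hy0]; ring
      · simp only [h, if_false]
        rw [hne w h]; ring
    rw [Finset.sum_sub_distrib, Finset.sum_sub_distrib, h1, sub_self, hp1] at h2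
    simp at h2
    have := (hpi x).ne'
    simp only [hy0, knorm, matpow, if_true]
    field_simp
    linarith
  · rw [hne x h]; simp [knorm, matpow, h]

theorem aux_PP_succ (K : V → V → ℝ) (n : ℕ) (f : V → ℝ) (x : V) :
    PP K (n + 1) f x = ∑ z, K x z * PP K n f z := by
  simp only [PP, matpow, Finset.mul_sum, Finset.sum_mul]
  rw [Finset.sum_comm]
  simp only [mul_assoc]

theorem aux_tele (K : V → V → ℝ) (pi : V → ℝ) (hsum : ∀ x, ∑ y, K x y = 1) (y : V) (h : V → ℝ)
    (hh : ∀ x, h x - ∑ z, K x z * h z = 1 - knorm K pi 0 x y) (n : ℕ) (x : V) :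
    PP K (n + 1) h x = PP K n h x + (knorm K pi n x y - 1) := by
  induction n generalizing x with
  | zero =>
    have h0 : ∀ x, PP K 0 h x = h x := fun x => by simp [PP, matpow]
    rw [aux_PP_succ]
    simp only [h0]
    linarith [hh x]
  | succ n ih =>
    have e : ∑ z, K x z * PP K (n + 1) h z
        = ∑ z, K x z * PP K n h z + (∑ z, K x z * knorm K pi n z y - ∑ z, K x z) := by
      rw [← Finset.sum_sub_distrib, ← Finset.sum_add_distrib]
      exact Finset.sum_congr rfl fun z _ => by rw [ih z]; ring
    rw [aux_PP_succ K (n + 1), e, ← aux_PP_succ, ← aux_knorm_succ, hsum]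

theorem aux_partial (K : V → V → ℝ) (pi : V → ℝ) (hsum : ∀ x, ∑ y, K x y = 1) (y : V) (h : V → ℝ)
    (hh : ∀ x, h x - ∑ z, K x z * h z = 1 - knorm K pi 0 x y) (N : ℕ) (x : V) :
    ∑ n ∈ range N, (knorm K pi (2 * n) x y + knorm K pi (2 * n + 1) x y - 2)
      = PP K (2 * N) h x - h x := by
  induction N with
  | zero => simp [PP, matpow]
  | succ N ih =>
    rw [Finset.sum_range_succ, ih, show 2 * (N + 1) = 2 * N + 1 + 1 by ring,
      aux_tele K pi hsum y h hh, aux_tele K pi hsum y h hh]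
    ring

theorem aux_PP_le (K : V → V → ℝ) (hK : ∀ x y, 0 ≤ K x y) (hsum : ∀ x, ∑ y, K x y = 1)
    (f : V → ℝ) (C : ℝ) (hC : ∀ x, f x ≤ C) (n : ℕ) (x : V) : PP K n f x ≤ C := by
  induction n generalizing x with
  | zero => simpa [PP, matpow] using hC x
  | succ n ih =>
    rw [aux_PP_succ]
    calc ∑ z, K x z * PP K n f z ≤ ∑ z, K x z * C :=
          Finset.sum_le_sum fun z _ => mul_le_mul_of_nonneg_left (ih z) (hK x z)
      _ = C := by rw [← Finset.sum_mul, hsum, one_mul]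

/-- For a periodic Markov kernel (period 2 with periodicity classes `A`,
`Aᶜ`), the series defining `𝒢` converges and `H(x,y) = 𝒢(y,y) − 𝒢(x,y)` if `x,y` are in
the same class, while `H(x,y) = 1 + 𝒢(y,y) − 𝒢(x,y)` otherwise. -/
theorem stmt4 (V : Type) [Fintype V] [DecidableEq V]
    (G : SimpleGraph V) (K : V → V → ℝ) (pi : V → ℝ)
    (hM : IsMarkovKernel G K pi) (A : Set V)
    (hper : ∀ x y : V, ((x ∈ A) ↔ (y ∈ A)) → K x y = 0) :
    (∀ x y : V,
      Summable fun n : ℕ => knorm K pi (2 * n) x y + knorm K pi (2 * n + 1) x y - 2) ∧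
    (∀ x y : V,
      hit K x y =
        if (x ∈ A ↔ y ∈ A) then greenPer K pi y y - greenPer K pi x y
        else 1 + greenPer K pi y y - greenPer K pi x y) := by
  have hsm := fun x y => aux_hit G K pi hM x y
  have hM' := hM
  obtain ⟨hG, hK, hsum, hpi, hp1, hrev, hadj, -, -⟩ := hM'
  obtain ⟨s, hsd⟩ : ∃ s : V → ℝ, ∀ x, s x = if x ∈ A then 1 else -1 := ⟨_, fun _ => rfl⟩
  have hs2 : ∀ x, s x * s x = 1 := fun x => by rw [hsd]; split_ifs <;> norm_num
  have hs : ∀ x y, K x y * (s x + s y) = 0 := fun x y => by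
    by_cases h : x ∈ A ↔ y ∈ A
    · rw [hper x y h, zero_mul]
    · have : s x + s y = 0 := by
        rw [hsd, hsd]
        by_cases hx : x ∈ A <;> by_cases hy : y ∈ A <;> simp [hx, hy] at h ⊢
      rw [this, mul_zero]
  have hdiag : ∀ x, Summable fun n => rr K pi s (2 * n) x x := by
    intro x
    refine summable_of_sum_range_le (c := (∑ z, |hit K z x|) + |hit K x x|) (fun n =>
      (aux_even K pi s hsum hpi hp1 hrev hs hs2 n x x).1) fun N => ?_
    have h := aux_partial K pi hsum x (fun z => hit K z x) (fun z => hsm z x) N x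
    simp only [aux_term K pi s, aux_odd K pi s hs hs2, add_zero] at h
    rw [h]
    have := aux_PP_le K hK hsum (fun z => hit K z x) (∑ z, |hit K z x|) (fun w =>
      (le_abs_self _).trans (Finset.single_le_sum (f := fun z => |hit K z x|)
        (fun _ _ => abs_nonneg _) (Finset.mem_univ w))) (2 * N) x
    linarith [neg_abs_le (hit K x x)]
  have heven : ∀ x y, Summable fun n => rr K pi s (2 * n) x y := fun x y =>
    Summable.of_norm_bounded ((hdiag x).add (hdiag y)) fun n =>
      (aux_even K pi s hsum hpi hp1 hrev hs hs2 n x y).2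
  have hodd : ∀ x y, Summable fun n => rr K pi s (2 * n + 1) x y := fun x y => by
    simp only [aux_rr_succ K pi s hsum hs]
    exact summable_sum fun z _ => (heven z y).mul_left _
  have hS : ∀ x y : V,
      Summable fun n : ℕ => knorm K pi (2 * n) x y + knorm K pi (2 * n + 1) x y - 2 := by
    intro x y
    simp only [aux_term K pi s]
    exact (heven x y).add (hodd x y)
  refine ⟨hS, fun x y => ?_⟩
  have hlim : ∀ x, greenPer K pi x y = (∑ z, pi z * (1 + s x * s z) * hit K z y) - hit K x y := by
    intro x
    refine tendsto_nhds_unique (hS x y).hasSum.tendsto_sum_nat ?_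
    simp only [aux_partial K pi hsum y (fun z => hit K z y) (fun z => hsm z y)]
    refine Filter.Tendsto.sub_const ?_ _
    simp only [PP]
    refine tendsto_finsetSum _ fun z _ => Filter.Tendsto.mul_const _ ?_
    have h1 := (((heven x z).tendsto_atTop_zero.add_const (1 + s x * s z)).const_mul (pi z))
    rw [zero_add] at h1
    refine h1.congr fun n => ?_
    have := (hpi z).ne'
    have e : (-1 : ℝ) ^ (2 * n) = 1 := by rw [pow_mul]; simp
    rw [rr, knorm, e]
    field_simp
    ring
  have hsplit : ∀ x, greenPer K pi x y
      = (∑ z, pi z * hit K z y) + s x * (∑ z, pi z * s z * hit K z y) - hit K x y := by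
    intro x
    rw [hlim x, Finset.mul_sum, ← Finset.sum_add_distrib]
    congr 1
    exact Finset.sum_congr rfl fun z _ => by ring
  have hb : 2 * ∑ z, pi z * s z * hit K z y = - s y := by
    have h1 := aux_adj K pi hrev s (fun z => hit K z y)
    simp only [aux_Ks K s hsum hs, mul_neg, neg_mul, Finset.sum_neg_distrib] at h1
    have h2 := aux_delta pi hpi K s y
    have h3 := aux_pis K pi s hsum hrev hs
    have h4 : ∑ z, pi z * s z * hit K z y - ∑ x, pi x * s x * ∑ z, K x z * hit K z y
        = ∑ z, pi z * s z - ∑ z, pi z * s z * knorm K pi 0 z y := by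
      rw [← Finset.sum_sub_distrib, ← Finset.sum_sub_distrib]
      refine Finset.sum_congr rfl fun z _ => ?_
      linear_combination pi z * s z * hsm z y
    linarith
  have hyy : hit K y y = 0 := by simp [hit, aux_avoid_self]
  rw [hsplit x, hsplit y, hyy]
  split_ifs with h
  · have : s x = s y := by
      rw [hsd, hsd]; simp only [h]
    rw [this]; ring
  · have : s x = - s y := by
      rw [hsd, hsd]
      by_cases hx : x ∈ A <;> by_cases hy : y ∈ A <;> simp [hx, hy] at h ⊢
    rw [this]
    linear_combination (- s y) * hb + hs2 y
end

section
/- For every θ ≥ 2 and every choice of constants in the Harnack assumptions there exists C > 0 such that: for every Markov kernel (Γ,K,π) that is lazy and satisfies the Harnack assumptions with parameter θ and those constants, and all x,y ∈ V, the normalized Green function satisfies |𝒢(x,y)| ≤ Σ_{n integer, d(x,y)^θ ≤ n ≤ 2D^θ} C / V(x, n^{1/θ}). -/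
open Finset
open scoped Classical

variable {V : Type*} [Fintype V] [DecidableEq V]

section Helpers

set_option linter.unusedSectionVars false

/-- Clean form of the assumptions. -/
structure HS (G : SimpleGraph V) (K : V → V → ℝ) (pi : V → ℝ) (θ CD CP C2 : ℝ) : Prop where
  conn : G.Connected
  K0 : ∀ x y, 0 ≤ K x y
  K1 : ∀ x, ∑ y, K x y = 1
  ppos : ∀ x, 0 < pi x
  psum : ∑ x, pi x = 1
  rev : ∀ x y, pi x * K x y = pi y * K y x
  loc : ∀ x y, K x y ≠ 0 → G.dist x y ≤ 1
  vd : ∀ x : V, ∀ r : ℝ, 0 < r → vol G pi x (2 * r) ≤ CD * vol G pi x r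
  poinc : ∀ x : V, ∀ r : ℝ, 0 < r → ∀ f : V → ℝ,
    (∑ z ∈ gball G x r, (f z - ballAvg G pi x r f) ^ 2 * pi z) ≤
      CP * r ^ θ * ∑ ξ ∈ gball G x r, ∑ ζ ∈ gball G x r, (f ξ - f ζ) ^ 2 * (pi ξ * K ξ ζ)
  cs : ∀ x : V, ∀ r : ℝ, 0 < r → ∃ σ : V → ℝ,
    (∀ y, 0 ≤ σ y) ∧ (∀ y, σ y ≤ 1) ∧
    (∀ y ∈ gball G x (r / 2), σ y = 1) ∧
    (∀ y, y ∉ gball G x r → σ y = 0) ∧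
    (∀ f : V → ℝ,
      (∑ z ∈ gball G x r, f z ^ 2 * ∑ y, (σ z - σ y) ^ 2 * (pi z * K z y)) ≤
        C2 * ((∑ z ∈ gball G x (2 * r), ∑ y ∈ gball G x (2 * r),
              (f z - f y) ^ 2 * (pi z * K z y)) +
            r ^ (-θ) * ∑ z ∈ gball G x (2 * r), f z ^ 2 * pi z))
  lazy : ∀ x, (1 : ℝ) / 2 ≤ K x x
  hθ : 2 ≤ θ
  hCP : 0 < CP
  hC2 : 0 < C2

/-- Energy on a set. -/
noncomputable def Ener (K : V → V → ℝ) (pi : V → ℝ) (A : Finset V) (f : V → ℝ) : ℝ :=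
  ∑ z ∈ A, ∑ w ∈ A, (f z - f w) ^ 2 * (pi z * K z w)

/-- Squared mass on a set. -/
noncomputable def Mass (pi : V → ℝ) (A : Finset V) (f : V → ℝ) : ℝ :=
  ∑ z ∈ A, f z ^ 2 * pi z

lemma mem_gball {G : SimpleGraph V} {x y : V} {r : ℝ} :
    y ∈ gball G x r ↔ (G.dist x y : ℝ) ≤ r := by
  simp [gball]

lemma clamp_sq (a b : ℝ) : (max 0 (min 1 a) - max 0 (min 1 b)) ^ 2 ≤ (a - b) ^ 2 := by
  apply sq_le_sq.mpr
  have h1 := abs_max_sub_max_le_max 0 (min 1 a) 0 (min 1 b)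
  have h2 := abs_min_sub_min_le_max 1 a 1 b
  simp at h1 h2
  exact h1.trans h2

theorem toHS {G : SimpleGraph V} {K : V → V → ℝ} {pi : V → ℝ}
    {θ p0 CD CP Ccs1 Ccs2 ε : ℝ} (hθ : 2 ≤ θ) (hM : IsMarkovKernel G K pi)
    (hH : Harnack G K pi θ p0 CD CP Ccs1 Ccs2 ε) (hL : Lazy K) :
    HS G K pi θ CD CP Ccs2 := by
  obtain ⟨hc, hK0, hK1, hp, hps, hrev, hadj, hnadj, -⟩ := hM
  obtain ⟨-, hCD, hCP, -, hC2, hε, -, hVD, hPI, hCS⟩ := hH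
  have key : ∀ (f : V → ℝ) (z y : V), (if G.Adj z y then (f z - f y) ^ 2 * K z y * pi z else 0)
      = (f z - f y) ^ 2 * (pi z * K z y) := by
    intro f z y
    split_ifs with h
    · ring
    · by_cases hzy : z = y
      · subst hzy; simp
      · rw [hnadj z y hzy h]; simp
  refine ⟨hc, hK0, hK1, hp, hps, hrev, ?_, hVD, ?_, ?_, hL, hθ, hCP, hC2⟩
  · intro x y h
    by_cases hxy : x = y
    · subst hxy; simp
    · have : G.Adj x y := by
        by_contra h'
        exact h (hnadj x y hxy h')
      rw [SimpleGraph.dist_eq_one_iff_adj.mpr this]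
  · intro x r hr f
    have := hPI x r hr f
    simp only [sq_abs, key] at this
    exact this
  · intro x r hr
    obtain ⟨σ, h1, h2, -, h4⟩ := hCS x r hr
    refine ⟨fun y => max 0 (min 1 (σ y)), fun y => le_max_left _ _,
      fun y => max_le zero_le_one (min_le_left _ _), ?_, ?_, ?_⟩
    · intro y hy
      have := h1 y hy
      simp [min_eq_left this]
    · intro y hy
      simp [h2 y hy]
    · intro f
      have := h4 r hr le_rfl f
      simp only [sq_abs, key, div_self hr.ne', Real.one_rpow, mul_one] at this
      refine le_trans ?_ this
      apply Finset.sum_le_sum; intro z _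
      apply mul_le_mul_of_nonneg_left _ (sq_nonneg _)
      apply Finset.sum_le_sum; intro y _
      apply mul_le_mul_of_nonneg_right (clamp_sq _ _)
      exact mul_nonneg (hp z).le (hK0 z y)

variable {G : SimpleGraph V} {K : V → V → ℝ} {pi : V → ℝ} {θ CD CP C2 : ℝ}

lemma HS.tri (h : HS G K pi θ CD CP C2) (x y z : V) :
    (G.dist x z : ℝ) ≤ G.dist x y + G.dist y z := by
  exact_mod_cast h.conn.dist_triangle

lemma HS.comm (_h : HS G K pi θ CD CP C2) (x y : V) :
    (G.dist x y : ℝ) = G.dist y x := by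
  rw [SimpleGraph.dist_comm]

lemma HS.locR (h : HS G K pi θ CD CP C2) {x y : V} (hk : K x y ≠ 0) :
    (G.dist x y : ℝ) ≤ 1 := by
  exact_mod_cast h.loc x y hk

lemma HS.a0 (h : HS G K pi θ CD CP C2) (x y : V) : 0 ≤ pi x * K x y :=
  mul_nonneg (h.ppos x).le (h.K0 x y)

lemma HS.sub (h : HS G K pi θ CD CP C2) {x z : V} {r R : ℝ}
    (hr : (G.dist x z : ℝ) + r ≤ R) : gball G z r ⊆ gball G x R := by
  intro w hw
  rw [mem_gball] at *
  have := h.tri x z w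
  linarith

lemma gball_mono {x : V} {r R : ℝ} (hr : r ≤ R) : gball G x r ⊆ gball G x R := by
  intro w hw
  rw [mem_gball] at *
  linarith

lemma self_mem {x : V} {r : ℝ} (hr : 0 ≤ r) : x ∈ gball G x r := by
  rw [mem_gball]; simpa using hr

lemma HS.vol_pos (h : HS G K pi θ CD CP C2) (x : V) {r : ℝ} (hr : 0 ≤ r) : 0 < vol G pi x r :=
  Finset.sum_pos (fun y _ => h.ppos y) ⟨x, self_mem hr⟩

lemma HS.vol_sub (h : HS G K pi θ CD CP C2) {x z : V} {r R : ℝ}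
    (hr : (G.dist x z : ℝ) + r ≤ R) : vol G pi z r ≤ vol G pi x R :=
  Finset.sum_le_sum_of_subset_of_nonneg (h.sub hr) (fun y _ _ => (h.ppos y).le)

lemma HS.vol_mono (h : HS G K pi θ CD CP C2) {x : V} {r R : ℝ}
    (hr : r ≤ R) : vol G pi x r ≤ vol G pi x R :=
  Finset.sum_le_sum_of_subset_of_nonneg (gball_mono hr) (fun y _ _ => (h.ppos y).le)

lemma HS.CD1 (h : HS G K pi θ CD CP C2) : 1 ≤ CD := by
  obtain ⟨x⟩ := h.conn.nonempty
  have h1 := h.vd x 1 one_pos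
  have h2 := h.vol_mono (x := x) (show (1:ℝ) ≤ 2 * 1 by norm_num)
  have h3 := h.vol_pos x zero_le_one
  by_contra hc
  push Not at hc
  nlinarith

lemma HS.vdn (h : HS G K pi θ CD CP C2) (n : ℕ) (x : V) {r : ℝ} (hr : 0 < r) :
    vol G pi x (2 ^ n * r) ≤ CD ^ n * vol G pi x r := by
  induction n with
  | zero => simp
  | succ n ih =>
    have h1 := h.vd x (2 ^ n * r) (by positivity)
    have h2 := h.CD1
    calc vol G pi x (2 ^ (n+1) * r) = vol G pi x (2 * (2 ^ n * r)) := by ring_nf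
      _ ≤ CD * vol G pi x (2 ^ n * r) := h1
      _ ≤ CD * (CD ^ n * vol G pi x r) := by gcongr
      _ = _ := by ring

/-- comparability of volumes -/
lemma HS.vol_cmp (h : HS G K pi θ CD CP C2) (n : ℕ) {x z : V} {r R : ℝ} (hr : 0 < r)
    (hR : (G.dist x z : ℝ) + R ≤ 2 ^ n * r) :
    vol G pi z R ≤ CD ^ n * vol G pi x r :=
  (h.vol_sub hR).trans (h.vdn n x hr)

/-- weight -/
noncomputable def om (G : SimpleGraph V) (pi : V → ℝ) (ρ : ℝ) (z : V) : ℝ := pi z / vol G pi z ρ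

lemma HS.om0 (h : HS G K pi θ CD CP C2) {ρ : ℝ} (hρ : 0 < ρ) (z : V) : 0 ≤ om G pi ρ z :=
  div_nonneg (h.ppos z).le (h.vol_pos z hρ.le).le

lemma HS.om_upper (h : HS G K pi θ CD CP C2) {ρ : ℝ} (hρ : 0 < ρ) (w : V) :
    ∑ z ∈ gball G w (2 * ρ), om G pi ρ z ≤ CD ^ 2 := by
  have hv := h.vol_pos w (r := 2 * ρ) (by positivity)
  calc ∑ z ∈ gball G w (2 * ρ), om G pi ρ z
      ≤ ∑ z ∈ gball G w (2 * ρ), pi z * (CD ^ 2 / vol G pi w (2 * ρ)) := by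
        apply Finset.sum_le_sum
        intro z hz
        rw [mem_gball] at hz
        have h1 : vol G pi w (2 * ρ) ≤ CD ^ 2 * vol G pi z ρ := by
          apply h.vol_cmp 2 hρ
          rw [h.comm z w]; linarith
        have h2 := h.vol_pos z hρ.le
        unfold om
        rw [div_eq_mul_inv]
        apply mul_le_mul_of_nonneg_left _ (h.ppos z).le
        rw [inv_eq_one_div, div_le_div_iff₀ h2 hv]
        linarith
    _ = CD ^ 2 := by
        rw [← Finset.sum_mul]
        change vol G pi w (2 * ρ) * _ = _
        field_simp

lemma HS.om_lower (h : HS G K pi θ CD CP C2) {ρ : ℝ} (hρ : 0 < ρ) (w : V) :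
    1 ≤ CD ^ 2 * ∑ z ∈ gball G w (ρ / 2), om G pi ρ z := by
  have hv := h.vol_pos w (r := ρ / 2) (by positivity)
  calc (1:ℝ) = ∑ z ∈ gball G w (ρ / 2), pi z * (1 / vol G pi w (ρ / 2)) := by
        rw [← Finset.sum_mul]
        change 1 = vol G pi w (ρ / 2) * _
        field_simp
    _ ≤ ∑ z ∈ gball G w (ρ / 2), CD ^ 2 * om G pi ρ z := by
        apply Finset.sum_le_sum
        intro z hz
        rw [mem_gball] at hz
        have h1 : vol G pi z ρ ≤ CD ^ 2 * vol G pi w (ρ / 2) := by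
          apply h.vol_cmp 2 (by positivity)
          linarith
        have h2 := h.vol_pos z hρ.le
        unfold om
        rw [show CD ^ 2 * (pi z / vol G pi z ρ) = pi z * (CD ^ 2 / vol G pi z ρ) by ring]
        apply mul_le_mul_of_nonneg_left _ (h.ppos z).le
        rw [div_le_div_iff₀ hv h2]
        linarith
    _ = _ := by rw [Finset.mul_sum]

lemma HS.cover_upper (h : HS G K pi θ CD CP C2) {ρ : ℝ} (hρ : 0 < ρ) (S T : Finset V)
    (F : V → ℝ) (hF : ∀ w, 0 ≤ F w) (hST : ∀ z ∈ S, gball G z (2 * ρ) ⊆ T) :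
    ∑ z ∈ S, om G pi ρ z * ∑ w ∈ gball G z (2 * ρ), F w ≤ CD ^ 2 * ∑ w ∈ T, F w := by
  have e1 : ∀ z ∈ S, om G pi ρ z * ∑ w ∈ gball G z (2 * ρ), F w
      = ∑ w ∈ T, if w ∈ gball G z (2 * ρ) then om G pi ρ z * F w else 0 := by
    intro z hz
    rw [Finset.mul_sum, ← Finset.sum_filter]
    congr 1
    ext w
    simp only [Finset.mem_filter]
    exact ⟨fun hw => ⟨hST z hz hw, hw⟩, fun hw => hw.2⟩
  rw [Finset.sum_congr rfl e1, Finset.sum_comm, Finset.mul_sum]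
  apply Finset.sum_le_sum
  intro w _
  calc ∑ z ∈ S, (if w ∈ gball G z (2 * ρ) then om G pi ρ z * F w else 0)
      ≤ ∑ z ∈ gball G w (2 * ρ), om G pi ρ z * F w := by
        rw [← Finset.sum_filter]
        apply Finset.sum_le_sum_of_subset_of_nonneg
        · intro z hz
          simp only [Finset.mem_filter, mem_gball] at hz ⊢
          rw [h.comm]; exact hz.2
        · intro z _ _
          exact mul_nonneg (h.om0 hρ z) (hF w)
    _ = (∑ z ∈ gball G w (2 * ρ), om G pi ρ z) * F w := by rw [Finset.sum_mul]
    _ ≤ CD ^ 2 * F w := mul_le_mul_of_nonneg_right (h.om_upper hρ w) (hF w)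

lemma HS.cover_lower (h : HS G K pi θ CD CP C2) {ρ : ℝ} (hρ : 0 < ρ) (S T : Finset V)
    (F : V → ℝ) (hF : ∀ w, 0 ≤ F w) (hST : ∀ w ∈ T, gball G w (ρ / 2) ⊆ S) :
    ∑ w ∈ T, F w ≤ CD ^ 2 * ∑ z ∈ S, om G pi ρ z * ∑ w ∈ gball G z ρ, F w := by
  have e1 : ∀ z ∈ S, om G pi ρ z * ∑ w ∈ gball G z ρ, F w
      = ∑ w, if w ∈ gball G z ρ then om G pi ρ z * F w else 0 := by
    intro z hz
    rw [Finset.mul_sum, ← Finset.sum_filter]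
    congr 1
    ext w
    simp
  rw [Finset.sum_congr rfl e1, Finset.sum_comm, Finset.mul_sum]
  have hnn : ∀ w z, 0 ≤ (if w ∈ gball G z ρ then om G pi ρ z * F w else 0) := by
    intro w z
    split_ifs
    · exact mul_nonneg (h.om0 hρ z) (hF w)
    · exact le_rfl
  have hCD := h.CD1
  refine le_trans ?_ (Finset.sum_le_sum_of_subset_of_nonneg (Finset.subset_univ T) ?_)
  · apply Finset.sum_le_sum
    intro w hw
    calc F w = 1 * F w := by ring
      _ ≤ (CD ^ 2 * ∑ z ∈ gball G w (ρ / 2), om G pi ρ z) * F w :=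
        mul_le_mul_of_nonneg_right (h.om_lower hρ w) (hF w)
      _ = CD ^ 2 * ∑ z ∈ gball G w (ρ / 2), om G pi ρ z * F w := by
        rw [mul_assoc, Finset.sum_mul]
      _ ≤ CD ^ 2 * ∑ z ∈ S, (if w ∈ gball G z ρ then om G pi ρ z * F w else 0) := by
        apply mul_le_mul_of_nonneg_left _ (by positivity)
        rw [← Finset.sum_filter]
        apply Finset.sum_le_sum_of_subset_of_nonneg
        · intro z hz
          simp only [Finset.mem_filter]
          refine ⟨hST w hw hz, ?_⟩
          rw [mem_gball] at hz ⊢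
          rw [h.comm]; linarith
        · intro z _ _
          exact mul_nonneg (h.om0 hρ z) (hF w)
  · intro w _ _
    exact mul_nonneg (by positivity) (Finset.sum_nonneg fun z _ => hnn w z)

lemma HS.Ener_nonneg (h : HS G K pi θ CD CP C2) (A : Finset V) (f : V → ℝ) :
    0 ≤ Ener K pi A f :=
  Finset.sum_nonneg fun z _ => Finset.sum_nonneg fun w _ => mul_nonneg (sq_nonneg _) (h.a0 z w)

lemma HS.Ener_mono (h : HS G K pi θ CD CP C2) {A B : Finset V} (hAB : A ⊆ B) (f : V → ℝ) :
    Ener K pi A f ≤ Ener K pi B f := by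
  have nn : ∀ z w, 0 ≤ (f z - f w) ^ 2 * (pi z * K z w) :=
    fun z w => mul_nonneg (sq_nonneg _) (h.a0 z w)
  calc Ener K pi A f ≤ ∑ z ∈ A, ∑ w ∈ B, (f z - f w) ^ 2 * (pi z * K z w) :=
        Finset.sum_le_sum fun z _ => Finset.sum_le_sum_of_subset_of_nonneg hAB fun w _ _ => nn z w
    _ ≤ _ := Finset.sum_le_sum_of_subset_of_nonneg hAB fun z _ _ =>
        Finset.sum_nonneg fun w _ => nn z w

lemma HS.Mass_nonneg (h : HS G K pi θ CD CP C2) (A : Finset V) (f : V → ℝ) :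
    0 ≤ Mass pi A f :=
  Finset.sum_nonneg fun z _ => mul_nonneg (sq_nonneg _) (h.ppos z).le

lemma HS.Mass_mono (h : HS G K pi θ CD CP C2) {A B : Finset V} (hAB : A ⊆ B) (f : V → ℝ) :
    Mass pi A f ≤ Mass pi B f :=
  Finset.sum_le_sum_of_subset_of_nonneg hAB fun z _ _ => mul_nonneg (sq_nonneg _) (h.ppos z).le

/-- splitting of the energy -/
lemma HS.Ener_split (h : HS G K pi θ CD CP C2) {A B : Finset V} (hAB : A ⊆ B) (f : V → ℝ) :
    Ener K pi (B \ A) f + Ener K pi A f ≤ Ener K pi B f := by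
  have nn : ∀ z w, 0 ≤ (f z - f w) ^ 2 * (pi z * K z w) :=
    fun z w => mul_nonneg (sq_nonneg _) (h.a0 z w)
  unfold Ener
  rw [← Finset.sum_sdiff hAB (f := fun z => ∑ w ∈ B, _)]
  gcongr
  · exact fun w _ _ => nn _ w
  · exact Finset.sdiff_subset
  · exact fun w _ _ => nn _ w

/-- trivial energy bound -/
lemma HS.Ener_le_Mass (h : HS G K pi θ CD CP C2) (A : Finset V) (f : V → ℝ) :
    Ener K pi A f ≤ 4 * Mass pi A f := by
  have s1 : ∑ z ∈ A, ∑ w ∈ A, f z ^ 2 * (pi z * K z w) ≤ Mass pi A f := by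
    apply Finset.sum_le_sum
    intro z _
    calc ∑ w ∈ A, f z ^ 2 * (pi z * K z w) ≤ ∑ w, f z ^ 2 * (pi z * K z w) :=
          Finset.sum_le_sum_of_subset_of_nonneg (Finset.subset_univ _)
            fun w _ _ => mul_nonneg (sq_nonneg _) (h.a0 z w)
      _ = f z ^ 2 * pi z := by
          rw [← Finset.mul_sum, ← Finset.mul_sum, h.K1, mul_one]
  have s2 : ∑ z ∈ A, ∑ w ∈ A, f w ^ 2 * (pi z * K z w) ≤ Mass pi A f := by
    rw [Finset.sum_comm]
    refine le_trans (le_of_eq ?_) s1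
    apply Finset.sum_congr rfl; intro z _
    apply Finset.sum_congr rfl; intro w _
    rw [h.rev w z]
  calc Ener K pi A f ≤ ∑ z ∈ A, ∑ w ∈ A,
        (2 * (f z ^ 2 * (pi z * K z w)) + 2 * (f w ^ 2 * (pi z * K z w))) := by
        apply Finset.sum_le_sum; intro z _
        apply Finset.sum_le_sum; intro w _
        have := h.a0 z w
        nlinarith [sq_nonneg (f z + f w), mul_nonneg (sq_nonneg (f z + f w)) this]
    _ = 2 * (∑ z ∈ A, ∑ w ∈ A, f z ^ 2 * (pi z * K z w)) +
        2 * (∑ z ∈ A, ∑ w ∈ A, f w ^ 2 * (pi z * K z w)) := by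
        simp only [Finset.sum_add_distrib, Finset.mul_sum]
    _ ≤ _ := by linarith


lemma HS.cutoff_local (h : HS G K pi θ CD CP C2) (z : V) {ρ : ℝ} (hρ : 1 ≤ ρ) (σ : V → ℝ)
    (s0 : ∀ y, 0 ≤ σ y) (s1 : ∀ y, σ y ≤ 1) (s2 : ∀ y, y ∉ gball G z ρ → σ y = 0)
    (f : V → ℝ)
    (s3 : (∑ z' ∈ gball G z ρ, f z' ^ 2 * ∑ y, (σ z' - σ y) ^ 2 * (pi z' * K z' y)) ≤
        C2 * (Ener K pi (gball G z (2 * ρ)) f + ρ ^ (-θ) * Mass pi (gball G z (2 * ρ)) f)) :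
    ∑ w, ∑ w', f w ^ 2 * ((σ w - σ w') ^ 2 * (pi w * K w w')) ≤
      (3 * C2 + 2) * (Ener K pi (gball G z (2 * ρ)) f +
        ρ ^ (-θ) * Mass pi (gball G z (2 * ρ)) f) := by
  set B := gball G z ρ with hB
  set B2 := gball G z (2 * ρ) with hB2
  set P : V → V → ℝ := fun w w' =>
    if w ∈ B then f w ^ 2 * ((σ w - σ w') ^ 2 * (pi w * K w w')) else 0 with hP
  set Q : V → V → ℝ := fun w w' =>
    if w ∈ B2 then (if w' ∈ B2 then (f w - f w') ^ 2 * (pi w * K w w') else 0) else 0 with hQ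
  have hsub : B ⊆ B2 := gball_mono (by linarith)
  have P0 : ∀ w w', 0 ≤ P w w' := by
    intro w w'; simp only [hP]; split_ifs
    · exact mul_nonneg (sq_nonneg _) (mul_nonneg (sq_nonneg _) (h.a0 _ _))
    · exact le_rfl
  have Q0 : ∀ w w', 0 ≤ Q w w' := by
    intro w w'; simp only [hQ]; split_ifs
    · exact mul_nonneg (sq_nonneg _) (h.a0 _ _)
    · exact le_rfl
    · exact le_rfl
  have hmain : ∀ w w', f w ^ 2 * ((σ w - σ w') ^ 2 * (pi w * K w w')) ≤
      P w w' + 2 * P w' w + 2 * Q w w' := by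
    intro w w'
    by_cases hw : w ∈ B
    · have e : P w w' = f w ^ 2 * ((σ w - σ w') ^ 2 * (pi w * K w w')) := by simp [hP, hw]
      rw [e]
      have := P0 w' w
      have := Q0 w w'
      linarith
    · by_cases hw' : w' ∈ B
      · by_cases hk : K w w' = 0
        · rw [hk]
          have := P0 w' w
          have := Q0 w w'
          have := P0 w w'
          simp only [mul_zero]
          linarith
        · have hd := h.locR hk
          have hwB2 : w ∈ B2 := by
            rw [hB2, mem_gball]
            rw [hB, mem_gball] at hw'
            have := h.tri z w' w
            rw [h.comm w' w] at this
            linarith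
          have e1 : P w' w = f w' ^ 2 * ((σ w - σ w') ^ 2 * (pi w * K w w')) := by
            simp only [hP, hw', if_true]
            rw [h.rev w' w]; ring
          have e2 : Q w w' = (f w - f w') ^ 2 * (pi w * K w w') := by
            simp [hQ, hwB2, hsub hw']
          rw [e1, e2]
          have ha := h.a0 w w'
          have := P0 w w'
          have hs : (σ w - σ w') ^ 2 ≤ 1 := by
            rw [s2 w hw]
            nlinarith [s0 w', s1 w']
          have hf : f w ^ 2 ≤ 2 * f w' ^ 2 + 2 * (f w - f w') ^ 2 := by
            nlinarith [sq_nonneg (2 * f w' - f w)]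
          have hsa : (σ w - σ w') ^ 2 * (pi w * K w w') ≤ 1 * (pi w * K w w') :=
            mul_le_mul_of_nonneg_right hs ha
          have hsa0 : 0 ≤ (σ w - σ w') ^ 2 * (pi w * K w w') := mul_nonneg (sq_nonneg _) ha
          calc f w ^ 2 * ((σ w - σ w') ^ 2 * (pi w * K w w'))
              ≤ (2 * f w' ^ 2 + 2 * (f w - f w') ^ 2) *
                ((σ w - σ w') ^ 2 * (pi w * K w w')) := mul_le_mul_of_nonneg_right hf hsa0
            _ = 2 * (f w' ^ 2 * ((σ w - σ w') ^ 2 * (pi w * K w w'))) +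
                2 * ((f w - f w') ^ 2 * ((σ w - σ w') ^ 2 * (pi w * K w w'))) := by ring
            _ ≤ 2 * (f w' ^ 2 * ((σ w - σ w') ^ 2 * (pi w * K w w'))) +
                2 * ((f w - f w') ^ 2 * (1 * (pi w * K w w'))) := by gcongr
            _ ≤ _ := by linarith
      · rw [s2 w hw, s2 w' hw']
        have := P0 w' w
        have := Q0 w w'
        have := P0 w w'
        simp only [sub_zero, ne_eq, OfNat.ofNat_ne_zero, not_false_eq_true, zero_pow, zero_mul,
          mul_zero]
        linarith
  have sP : ∑ w, ∑ w', P w w' ≤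
      C2 * (Ener K pi B2 f + ρ ^ (-θ) * Mass pi B2 f) := by
    refine le_trans (le_of_eq ?_) s3
    have : ∀ w, ∑ w', P w w' =
        if w ∈ B then f w ^ 2 * ∑ y, (σ w - σ y) ^ 2 * (pi w * K w y) else 0 := by
      intro w
      simp only [hP]
      split_ifs
      · rw [Finset.mul_sum]
      · simp
    rw [Finset.sum_congr rfl fun w _ => this w]
    simp
  have sP' : ∑ w, ∑ w', P w' w = ∑ w, ∑ w', P w w' := Finset.sum_comm
  have sQ : ∑ w, ∑ w', Q w w' = Ener K pi B2 f := by
    have : ∀ w, ∑ w', Q w w' =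
        if w ∈ B2 then ∑ w' ∈ B2, (f w - f w') ^ 2 * (pi w * K w w') else 0 := by
      intro w
      simp only [hQ]
      split_ifs <;> simp
    rw [Finset.sum_congr rfl fun w _ => this w]
    simp [Ener]
  have hM : 0 ≤ ρ ^ (-θ) * Mass pi B2 f :=
    mul_nonneg (Real.rpow_nonneg (by linarith) _) (h.Mass_nonneg _ _)
  calc ∑ w, ∑ w', f w ^ 2 * ((σ w - σ w') ^ 2 * (pi w * K w w'))
      ≤ ∑ w, ∑ w', (P w w' + 2 * P w' w + 2 * Q w w') :=
        Finset.sum_le_sum fun w _ => Finset.sum_le_sum fun w' _ => hmain w w'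
    _ = ∑ w, ∑ w', P w w' + 2 * ∑ w, ∑ w', P w' w + 2 * ∑ w, ∑ w', Q w w' := by
        simp only [Finset.sum_add_distrib, Finset.mul_sum]
    _ ≤ _ := by
        rw [sP', sQ]
        nlinarith

lemma HS.cutoff (h : HS G K pi θ CD CP C2) (x : V) {m ρ : ℝ} (hρ : 1 ≤ ρ) :
    ∃ φ : V → ℝ, (∀ w, 0 ≤ φ w) ∧ (∀ w, φ w ≤ 1) ∧ (∀ w ∈ gball G x (m - ρ), φ w = 1) ∧
      (∀ w, w ∉ gball G x (m + ρ) → φ w = 0) ∧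
      ∀ f : V → ℝ, ∑ w, ∑ w', f w ^ 2 * ((φ w - φ w') ^ 2 * (pi w * K w w')) ≤
        CD ^ 8 * (3 * C2 + 2) *
          (Ener K pi (gball G x (m + 6 * ρ) \ gball G x (m - 6 * ρ)) f +
            ρ ^ (-θ) * Mass pi (gball G x (m + 6 * ρ) \ gball G x (m - 6 * ρ)) f) := by
  have hρ0 : 0 < ρ := by linarith
  choose σ s0 s1 s2 s3 s4 using fun z => h.cs z ρ hρ0
  set S := gball G x m with hS
  set S' := S \ gball G x (m - 4 * ρ) with hS'
  set T := gball G x (m + 6 * ρ) \ gball G x (m - 6 * ρ) with hT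
  set ψ : V → ℝ := fun w => CD ^ 2 * ∑ z ∈ S, om G pi ρ z * σ z w with hψ
  have hCD := h.CD1
  have ψ0 : ∀ w, 0 ≤ ψ w := fun w => mul_nonneg (by positivity)
    (Finset.sum_nonneg fun z _ => mul_nonneg (h.om0 hρ0 z) (s0 z w))
  have φ1 : ∀ w ∈ gball G x (m - ρ), min 1 (ψ w) = 1 := by
    intro w hw
    rw [mem_gball] at hw
    apply min_eq_left
    refine (h.om_lower hρ0 w).trans ?_
    apply mul_le_mul_of_nonneg_left _ (by positivity)
    calc ∑ z ∈ gball G w (ρ / 2), om G pi ρ z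
        = ∑ z ∈ gball G w (ρ / 2), om G pi ρ z * σ z w := by
          apply Finset.sum_congr rfl
          intro z hz
          rw [s2 z w, mul_one]
          rw [mem_gball] at hz ⊢
          rw [h.comm]; exact hz
      _ ≤ _ := by
          apply Finset.sum_le_sum_of_subset_of_nonneg
          · apply h.sub; linarith
          · exact fun z _ _ => mul_nonneg (h.om0 hρ0 z) (s0 z w)
  refine ⟨fun w => min 1 (ψ w), fun w => le_min zero_le_one (ψ0 w), fun w => min_le_left _ _,
    φ1, ?_, ?_⟩
  · intro w hw
    have : ψ w = 0 := by
      simp only [hψ]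
      rw [Finset.sum_eq_zero, mul_zero]
      intro z hz
      rw [s3 z w, mul_zero]
      rw [mem_gball] at hw ⊢
      rw [hS, mem_gball] at hz
      intro hc
      have := h.tri x z w
      linarith
    simp [this]
  · intro f
    have hpt : ∀ w w', (min 1 (ψ w) - min 1 (ψ w')) ^ 2 * (pi w * K w w') ≤
        CD ^ 6 * ∑ z ∈ S', om G pi ρ z * ((σ z w - σ z w') ^ 2 * (pi w * K w w')) := by
      intro w w'
      have hnn : 0 ≤ CD ^ 6 * ∑ z ∈ S', om G pi ρ z *
          ((σ z w - σ z w') ^ 2 * (pi w * K w w')) :=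
        mul_nonneg (by positivity) (Finset.sum_nonneg fun z _ => mul_nonneg (h.om0 hρ0 z)
          (mul_nonneg (sq_nonneg _) (h.a0 _ _)))
      by_cases hk : K w w' = 0
      · rw [hk] at hnn ⊢; simpa using hnn
      have hd := h.locR hk
      by_cases hb : w ∈ gball G x (m - ρ) ∧ w' ∈ gball G x (m - ρ)
      · rw [φ1 w hb.1, φ1 w' hb.2]; simpa using hnn
      have hwx : m - ρ - 1 < G.dist x w := by
        by_contra hc
        push Not at hc
        apply hb
        rw [mem_gball, mem_gball]
        constructor
        · linarith
        · have := h.tri x w w'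
          linarith
      set Q := S'.filter (fun z => z ∈ gball G w (2 * ρ)) with hQ
      have hvan : ∀ z ∈ S, z ∉ Q → σ z w - σ z w' = 0 := by
        intro z hz hzQ
        by_contra hne
        apply hzQ
        have hdz : (G.dist w z : ℝ) ≤ ρ + 1 := by
          by_cases hw : w ∈ gball G z ρ
          · rw [mem_gball, h.comm] at hw; linarith
          · by_cases hw' : w' ∈ gball G z ρ
            · rw [mem_gball, h.comm] at hw'
              have := h.tri w w' z
              linarith
            · exfalso; apply hne; rw [s3 z w hw, s3 z w' hw', sub_zero]
        simp only [hQ, hS', Finset.mem_filter, Finset.mem_sdiff, mem_gball]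
        refine ⟨⟨hz, ?_⟩, by linarith⟩
        intro hc
        have := h.tri x z w
        rw [h.comm z w] at this
        linarith
      have hQS : Q ⊆ S := (Finset.filter_subset _ _).trans Finset.sdiff_subset
      have hdiff : ψ w - ψ w' = CD ^ 2 * ∑ z ∈ Q, om G pi ρ z * (σ z w - σ z w') := by
        simp only [hψ]
        rw [← mul_sub, ← Finset.sum_sub_distrib]
        congr 1
        rw [Finset.sum_subset hQS (f := fun z => om G pi ρ z * (σ z w - σ z w'))
          (fun z hz hzQ => by rw [hvan z hz hzQ, mul_zero])]
        apply Finset.sum_congr rfl; intro z _; ring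
      have hcs : (∑ z ∈ Q, om G pi ρ z * (σ z w - σ z w')) ^ 2 ≤
          (∑ z ∈ Q, om G pi ρ z) * ∑ z ∈ Q, om G pi ρ z * (σ z w - σ z w') ^ 2 := by
        apply Finset.sum_sq_le_sum_mul_sum_of_sq_le_mul
        · exact fun z _ => h.om0 hρ0 z
        · exact fun z _ => mul_nonneg (h.om0 hρ0 z) (sq_nonneg _)
        · intro z _; exact le_of_eq (by ring)
      have hQu : ∑ z ∈ Q, om G pi ρ z ≤ CD ^ 2 := by
        refine le_trans ?_ (h.om_upper hρ0 w)
        apply Finset.sum_le_sum_of_subset_of_nonneg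
        · intro z hz; exact (Finset.mem_filter.mp hz).2
        · exact fun z _ _ => h.om0 hρ0 z
      have hQS' : ∑ z ∈ Q, om G pi ρ z * (σ z w - σ z w') ^ 2 ≤
          ∑ z ∈ S', om G pi ρ z * (σ z w - σ z w') ^ 2 := by
        apply Finset.sum_le_sum_of_subset_of_nonneg (Finset.filter_subset _ _)
        exact fun z _ _ => mul_nonneg (h.om0 hρ0 z) (sq_nonneg _)
      have hQ0 : 0 ≤ ∑ z ∈ Q, om G pi ρ z * (σ z w - σ z w') ^ 2 :=
        Finset.sum_nonneg fun z _ => mul_nonneg (h.om0 hρ0 z) (sq_nonneg _)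
      have hmin : (min 1 (ψ w) - min 1 (ψ w')) ^ 2 ≤ (ψ w - ψ w') ^ 2 := by
        apply sq_le_sq.mpr
        have h2 := abs_min_sub_min_le_max 1 (ψ w) 1 (ψ w')
        simpa using h2
      have hfin : (min 1 (ψ w) - min 1 (ψ w')) ^ 2 ≤
          CD ^ 6 * ∑ z ∈ S', om G pi ρ z * (σ z w - σ z w') ^ 2 := by
        calc _ ≤ (ψ w - ψ w') ^ 2 := hmin
          _ = CD ^ 4 * (∑ z ∈ Q, om G pi ρ z * (σ z w - σ z w')) ^ 2 := by rw [hdiff]; ring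
          _ ≤ CD ^ 4 * ((∑ z ∈ Q, om G pi ρ z) *
              ∑ z ∈ Q, om G pi ρ z * (σ z w - σ z w') ^ 2) := by gcongr
          _ ≤ CD ^ 4 * (CD ^ 2 * ∑ z ∈ S', om G pi ρ z * (σ z w - σ z w') ^ 2) := by gcongr
          _ = _ := by ring
      calc _ ≤ (CD ^ 6 * ∑ z ∈ S', om G pi ρ z * (σ z w - σ z w') ^ 2) * (pi w * K w w') :=
            mul_le_mul_of_nonneg_right hfin (h.a0 _ _)
        _ = _ := by
            rw [mul_assoc, Finset.sum_mul]
            congr 1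
            apply Finset.sum_congr rfl; intro z _; ring
    set X : V → ℝ := fun z => ∑ w, ∑ w', f w ^ 2 * ((σ z w - σ z w') ^ 2 * (pi w * K w w'))
      with hX
    have step1 : ∑ w, ∑ w', f w ^ 2 * ((min 1 (ψ w) - min 1 (ψ w')) ^ 2 * (pi w * K w w')) ≤
        CD ^ 6 * ∑ z ∈ S', om G pi ρ z * X z := by
      calc _ ≤ ∑ w, ∑ w', f w ^ 2 * (CD ^ 6 * ∑ z ∈ S', om G pi ρ z *
            ((σ z w - σ z w') ^ 2 * (pi w * K w w'))) := by
            apply Finset.sum_le_sum; intro w _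
            apply Finset.sum_le_sum; intro w' _
            exact mul_le_mul_of_nonneg_left (hpt w w') (sq_nonneg _)
        _ = ∑ w, ∑ w', ∑ z ∈ S', CD ^ 6 * (om G pi ρ z *
            (f w ^ 2 * ((σ z w - σ z w') ^ 2 * (pi w * K w w')))) := by
            apply Finset.sum_congr rfl; intro w _
            apply Finset.sum_congr rfl; intro w' _
            rw [Finset.mul_sum, Finset.mul_sum]
            apply Finset.sum_congr rfl; intro z _; ring
        _ = ∑ w, ∑ z ∈ S', ∑ w', CD ^ 6 * (om G pi ρ z *
            (f w ^ 2 * ((σ z w - σ z w') ^ 2 * (pi w * K w w')))) :=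
            Finset.sum_congr rfl fun w _ => Finset.sum_comm
        _ = ∑ z ∈ S', ∑ w, ∑ w', CD ^ 6 * (om G pi ρ z *
            (f w ^ 2 * ((σ z w - σ z w') ^ 2 * (pi w * K w w')))) := Finset.sum_comm
        _ = _ := by
            simp only [hX, Finset.mul_sum]
    have step2 : ∀ z ∈ S', X z ≤ (3 * C2 + 2) * (Ener K pi (gball G z (2 * ρ)) f +
        ρ ^ (-θ) * Mass pi (gball G z (2 * ρ)) f) := fun z _ =>
      h.cutoff_local z hρ (σ z) (s0 z) (s1 z) (s3 z) f (s4 z f)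
    have hsubT : ∀ z ∈ S', gball G z (2 * ρ) ⊆ T := by
      intro z hz w hw
      simp only [hS', hS, hT, Finset.mem_sdiff, mem_gball, not_le] at *
      have h1 := h.tri x z w
      have h2 := h.tri x w z
      rw [h.comm w z] at h2
      constructor <;> linarith
    set R : V → ℝ := fun w => ∑ w' ∈ T, (f w - f w') ^ 2 * (pi w * K w w') + ρ ^ (-θ) *
      (f w ^ 2 * pi w) with hR
    have hρθ : 0 ≤ ρ ^ (-θ) := Real.rpow_nonneg hρ0.le _
    have hR0 : ∀ w, 0 ≤ R w := fun w => add_nonneg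
      (Finset.sum_nonneg fun w' _ => mul_nonneg (sq_nonneg _) (h.a0 _ _))
      (mul_nonneg hρθ (mul_nonneg (sq_nonneg _) (h.ppos w).le))
    have hC2 := h.hC2
    have step3 : ∀ z ∈ S', X z ≤ (3 * C2 + 2) * ∑ w ∈ gball G z (2 * ρ), R w := by
      intro z hz
      refine (step2 z hz).trans ?_
      apply mul_le_mul_of_nonneg_left _ (by positivity)
      simp only [hR, Finset.sum_add_distrib, ← Finset.mul_sum]
      apply add_le_add _ le_rfl
      apply Finset.sum_le_sum; intro w _
      apply Finset.sum_le_sum_of_subset_of_nonneg (hsubT z hz)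
      exact fun w' _ _ => mul_nonneg (sq_nonneg _) (h.a0 _ _)
    calc _ ≤ CD ^ 6 * ∑ z ∈ S', om G pi ρ z * X z := step1
      _ ≤ CD ^ 6 * ∑ z ∈ S', om G pi ρ z * ((3 * C2 + 2) * ∑ w ∈ gball G z (2 * ρ), R w) := by
          apply mul_le_mul_of_nonneg_left _ (by positivity)
          apply Finset.sum_le_sum; intro z hz
          exact mul_le_mul_of_nonneg_left (step3 z hz) (h.om0 hρ0 z)
      _ = CD ^ 6 * (3 * C2 + 2) * ∑ z ∈ S', om G pi ρ z * ∑ w ∈ gball G z (2 * ρ), R w := by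
          rw [mul_assoc]; congr 1
          rw [Finset.mul_sum S' _ (3 * C2 + 2)]
          apply Finset.sum_congr rfl; intro z _; ring
      _ ≤ CD ^ 6 * (3 * C2 + 2) * (CD ^ 2 * ∑ w ∈ T, R w) := by
          apply mul_le_mul_of_nonneg_left _ (by positivity)
          exact h.cover_upper hρ0 S' T R hR0 hsubT
      _ = CD ^ 8 * (3 * C2 + 2) * (Ener K pi T f + ρ ^ (-θ) * Mass pi T f) := by
          simp only [hR, Finset.sum_add_distrib, ← Finset.mul_sum, Ener, Mass]
          ring


/-- discrete Laplacian -/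
noncomputable def lap (K : V → V → ℝ) (u : V → ℝ) (z : V) : ℝ := u z - ∑ w, K z w * u w

lemma HS.green_id (h : HS G K pi θ CD CP C2) (u ψ : V → ℝ) :
    ∑ z, ∑ w, (u z - u w) * (ψ z - ψ w) * (pi z * K z w) = 2 * ∑ z, ψ z * pi z * lap K u z := by
  have e1 : ∑ z, ∑ w, (u z - u w) * ψ z * (pi z * K z w) = ∑ z, ψ z * pi z * lap K u z := by
    apply Finset.sum_congr rfl; intro z _
    have : lap K u z = ∑ w, K z w * (u z - u w) := by
      simp only [mul_sub, Finset.sum_sub_distrib, ← Finset.sum_mul, h.K1, one_mul, lap]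
    rw [this, Finset.mul_sum]
    apply Finset.sum_congr rfl; intro w _; ring
  have e2 : ∑ z, ∑ w, (u z - u w) * ψ w * (pi z * K z w) = - ∑ z, ψ z * pi z * lap K u z := by
    rw [← e1, Finset.sum_comm, ← Finset.sum_neg_distrib]
    apply Finset.sum_congr rfl; intro z _
    rw [← Finset.sum_neg_distrib]
    apply Finset.sum_congr rfl; intro w _
    rw [h.rev w z]; ring
  calc _ = ∑ z, ∑ w, (u z - u w) * ψ z * (pi z * K z w) -
      ∑ z, ∑ w, (u z - u w) * ψ w * (pi z * K z w) := by
        rw [← Finset.sum_sub_distrib]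
        apply Finset.sum_congr rfl; intro z _
        rw [← Finset.sum_sub_distrib]
        apply Finset.sum_congr rfl; intro w _; ring
    _ = _ := by rw [e1, e2]; ring

lemma HS.cacc1 (h : HS G K pi θ CD CP C2) (u φ : V → ℝ) (l b : ℝ)
    (hb : ∀ z, φ z ≠ 0 → lap K u z ≤ b) (f : V → ℝ) (hf : ∀ z, f z = max (u z - l) 0) :
    Ener K pi univ (fun z => φ z * f z) ≤ 2 * b * ∑ z, φ z ^ 2 * f z * pi z +
      ∑ z, ∑ w, f z ^ 2 * ((φ z - φ w) ^ 2 * (pi z * K z w)) := by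
  set X := ∑ z, ∑ w, f z ^ 2 * ((φ z - φ w) ^ 2 * (pi z * K z w)) with hX
  have f0 : ∀ z, 0 ≤ f z := fun z => by rw [hf]; exact le_max_right _ _
  have hsym : ∑ z, ∑ w, f w ^ 2 * ((φ z - φ w) ^ 2 * (pi z * K z w)) = X := by
    rw [hX, Finset.sum_comm]
    apply Finset.sum_congr rfl; intro z _
    apply Finset.sum_congr rfl; intro w _
    rw [h.rev w z]; ring
  have hpt : ∀ z w, (φ z * f z - φ w * f w) ^ 2 * (pi z * K z w) ≤
      (u z - u w) * (φ z ^ 2 * f z - φ w ^ 2 * f w) * (pi z * K z w) +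
      (f z ^ 2 * ((φ z - φ w) ^ 2 * (pi z * K z w)) +
       f w ^ 2 * ((φ z - φ w) ^ 2 * (pi z * K z w))) / 2 := by
    intro z w
    have ha := h.a0 z w
    have h1 : (f z - f w) * (φ z ^ 2 * f z - φ w ^ 2 * f w) ≤
        (u z - u w) * (φ z ^ 2 * f z - φ w ^ 2 * f w) := by
      rw [hf z, hf w]
      have a1 := sq_nonneg (φ z)
      have a2 := sq_nonneg (φ w)
      rcases le_total (u z - l) 0 with hz | hz <;> rcases le_total (u w - l) 0 with hw | hw
      · rw [max_eq_right hz, max_eq_right hw]; simp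
      · rw [max_eq_right hz, max_eq_left hw]
        nlinarith [mul_nonneg (mul_nonneg a2 hw) (neg_nonneg.mpr hz)]
      · rw [max_eq_left hz, max_eq_right hw]
        nlinarith [mul_nonneg (mul_nonneg a1 hz) (neg_nonneg.mpr hw)]
      · rw [max_eq_left hz, max_eq_left hw]
        apply le_of_eq; ring
    have h2 : (φ z * f z - φ w * f w) ^ 2 ≤ (u z - u w) * (φ z ^ 2 * f z - φ w ^ 2 * f w) +
        (f z ^ 2 + f w ^ 2) / 2 * (φ z - φ w) ^ 2 := by
      nlinarith [mul_nonneg (sq_nonneg (f z - f w)) (sq_nonneg (φ z - φ w))]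
    nlinarith [mul_le_mul_of_nonneg_right h2 ha]
  have hg := h.green_id u (fun z => φ z ^ 2 * f z)
  calc Ener K pi univ (fun z => φ z * f z)
      ≤ ∑ z, ∑ w, ((u z - u w) * (φ z ^ 2 * f z - φ w ^ 2 * f w) * (pi z * K z w) +
      (f z ^ 2 * ((φ z - φ w) ^ 2 * (pi z * K z w)) +
       f w ^ 2 * ((φ z - φ w) ^ 2 * (pi z * K z w))) / 2) :=
        Finset.sum_le_sum fun z _ => Finset.sum_le_sum fun w _ => hpt z w
    _ = 2 * ∑ z, φ z ^ 2 * f z * pi z * lap K u z + X := by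
        simp only [Finset.sum_add_distrib, ← Finset.sum_div]
        rw [hg, hsym, ← hX]; ring
    _ ≤ _ := by
        rw [mul_assoc 2 b, Finset.mul_sum univ _ b]
        gcongr 2 * ?_ + X
        apply Finset.sum_le_sum; intro z _
        by_cases hz : φ z = 0
        · simp [hz]
        · have := mul_nonneg (mul_nonneg (sq_nonneg (φ z)) (f0 z)) (h.ppos z).le
          nlinarith [mul_le_mul_of_nonneg_left (hb z hz) this]

lemma HS.cacc2 (h : HS G K pi θ CD CP C2) (x : V) {s t : ℝ} (hst : s + 12 ≤ t)
    (u : V → ℝ) (l b : ℝ) (b0 : 0 ≤ b) 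
    (hb : ∀ z ∈ gball G x t, lap K u z ≤ b) (f : V → ℝ) (hf : ∀ z, f z = max (u z - l) 0) :
    Ener K pi (gball G x s) f ≤ 2 * (b * ∑ z ∈ gball G x t, f z * pi z) +
      CD ^ 8 * (3 * C2 + 2) * (Ener K pi (gball G x t) f - Ener K pi (gball G x s) f +
        ((t - s) / 12) ^ (-θ) * Mass pi (gball G x t) f) := by
  obtain ⟨φ, p0, p1, p2, p3, p4⟩ := h.cutoff x (m := (s + t) / 2) (ρ := (t - s) / 12)
    (by linarith)
  have e1 : (s + t) / 2 + 6 * ((t - s) / 12) = t := by ring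
  have e2 : (s + t) / 2 - 6 * ((t - s) / 12) = s := by ring
  rw [e1, e2] at p4
  have f0 : ∀ z, 0 ≤ f z := fun z => by rw [hf]; exact le_max_right _ _
  have p3' : ∀ w, w ∉ gball G x t → φ w = 0 := by
    intro w hw; apply p3; intro hc; exact hw (gball_mono (by linarith) hc)
  have c1 := h.cacc1 u φ l b (fun z hz => hb z (by by_contra hc; exact hz (p3' z hc))) f hf
  have c2 : Ener K pi (gball G x s) f ≤ Ener K pi univ (fun z => φ z * f z) := by
    refine le_trans (le_of_eq ?_) (h.Ener_mono (Finset.subset_univ (gball G x s)) _)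
    unfold Ener
    apply Finset.sum_congr rfl; intro z hz
    apply Finset.sum_congr rfl; intro w hw
    beta_reduce
    rw [p2 z (gball_mono (by linarith) hz), p2 w (gball_mono (by linarith) hw)]; ring
  have c3 : ∑ z, φ z ^ 2 * f z * pi z ≤ ∑ z ∈ gball G x t, f z * pi z := by
    rw [← Finset.sum_subset (Finset.subset_univ (gball G x t))
      (fun z _ hz => by rw [p3' z hz]; ring)]
    apply Finset.sum_le_sum; intro z _
    have h1 : φ z ^ 2 ≤ 1 := by nlinarith [p0 z, p1 z]
    have := mul_nonneg (f0 z) (h.ppos z).le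
    nlinarith
  have c4 := p4 f
  have c5 := h.Ener_split (gball_mono (G := G) (x := x) (show s ≤ t by linarith)) f
  have c6 := h.Mass_mono (Finset.sdiff_subset (s := gball G x t) (t := gball G x s)) f
  have hC2 := h.hC2
  have hCD := h.CD1
  have hr : 0 ≤ ((t - s) / 12) ^ (-θ) := Real.rpow_nonneg (by linarith) _
  have c7 : CD ^ 8 * (3 * C2 + 2) * (Ener K pi (gball G x t \ gball G x s) f +
      ((t - s) / 12) ^ (-θ) * Mass pi (gball G x t \ gball G x s) f) ≤
      CD ^ 8 * (3 * C2 + 2) * (Ener K pi (gball G x t) f - Ener K pi (gball G x s) f +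
        ((t - s) / 12) ^ (-θ) * Mass pi (gball G x t) f) := by
    gcongr
    linarith
  have c8 := mul_le_mul_of_nonneg_left c3 b0
  linarith

lemma iter_real (CA θ : ℝ) (hCA : 0 < CA) (hθ : 2 ≤ θ) : ∃ A > (0 : ℝ),
    ∀ (E : ℝ → ℝ) (F H r : ℝ), 0 ≤ F → 0 ≤ H → (∀ s ≤ r, E s ≤ 4 * F) →
    (∀ s t, s + 12 ≤ t → t ≤ r → E s ≤ 2 * H + CA * (E t - E s + ((t - s) / 12) ^ (-θ) * F)) →
    ∀ s < r, E s ≤ A * ((r - s) ^ (-θ) * F + H) := by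
  set ϑ := CA / (1 + CA) with hϑ
  have t0 : 0 < ϑ := by positivity
  have t1 : ϑ < 1 := by rw [hϑ, div_lt_one (by positivity)]; linarith
  set τ := ((1 + ϑ) / 2) ^ (1 / θ) with hτ
  have τ0 : 0 < τ := by positivity
  have τ1 : τ < 1 := Real.rpow_lt_one (by positivity) (by linarith) (by positivity)
  have hτθ : τ ^ (-θ) = 2 / (1 + ϑ) := by
    rw [hτ, ← Real.rpow_mul (by positivity)]
    have : 1 / θ * -θ = -1 := by field_simp
    rw [this, Real.rpow_neg_one, inv_div]
  set κ := ϑ * τ ^ (-θ) with hκ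
  have κ1 : κ < 1 := by
    rw [hκ, hτθ, mul_div_assoc', div_lt_one (by positivity)]; linarith
  have κϑ : ϑ ≤ κ := by
    rw [hκ, hτθ, mul_div_assoc', le_div_iff₀ (by positivity)]; nlinarith
  set P := ((1 - τ) / 12) ^ (-θ) with hP
  have h1τ : 0 < 1 - τ := by linarith
  have P0 : 0 < P := by positivity
  refine ⟨(4 * P + 2) / (1 - κ), div_pos (by positivity) (by linarith), ?_⟩
  set A := (4 * P + 2) / (1 - κ) with hA
  have hA1 : A * (1 - κ) = 4 * P + 2 := div_mul_cancel₀ _ (by linarith)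
  have hA0 : 0 < A := div_pos (by positivity) (by linarith)
  have hA4 : 4 * P ≤ A := by nlinarith
  intro E F H r F0 H0 h4 hE
  have key : ∀ n : ℕ, ∀ s < r, r - s ≤ n → E s ≤ A * ((r - s) ^ (-θ) * F + H) := by
    intro n
    induction n with
    | zero => intro s hs hn; simp at hn; linarith
    | succ n ih =>
      intro s hs hn
      have hg : 0 < r - s := by linarith
      have hg' : 0 < (r - s) ^ (-θ) := by positivity
      by_cases hc : (1 - τ) * (r - s) < 12
      · have h2 : 1 ≤ P * (r - s) ^ (-θ) := by
          rw [hP, ← Real.mul_rpow (by positivity) (by positivity)]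
          apply Real.one_le_rpow_of_pos_of_le_one_of_nonpos (by positivity)
          · linarith
          · linarith
        have h3 := h4 s hs.le
        have h5 : F ≤ P * (r - s) ^ (-θ) * F := by nlinarith
        have h6 : 4 * P * ((r - s) ^ (-θ) * F) ≤ A * ((r - s) ^ (-θ) * F) := by gcongr
        nlinarith
      · push Not at hc
        set t := s + (1 - τ) * (r - s) with ht
        have hrt : r - t = τ * (r - s) := by rw [ht]; ring
        have htr : 0 < τ * (r - s) := by positivity
        have i1 := ih t (by linarith) (by push_cast at hn; linarith)
        have i2 := hE s t (by linarith) (by linarith)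
        rw [hrt, Real.mul_rpow τ0.le hg.le] at i1
        have e3 : (t - s) / 12 = (1 - τ) / 12 * (r - s) := by rw [ht]; ring
        rw [e3, Real.mul_rpow (by positivity) hg.le, ← hP] at i2
        set g := (r - s) ^ (-θ) * F with hgg
        have hg0 : 0 ≤ g := by positivity
        -- divide
        have i3 : E s ≤ 2 * H + ϑ * E t + P * g := by
          have : (1 + CA) * E s ≤ (1 + CA) * (2 * H + ϑ * E t + P * g) := by
            have e4 : (1 + CA) * ϑ = CA := by rw [hϑ]; field_simp
            have e5 : (1 + CA) * (2 * H + ϑ * E t + P * g) =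
              2 * H + CA * 2 * H + ((1 + CA) * ϑ) * E t + P * g + CA * (P * g) := by ring
            rw [e5, e4]
            have : 0 ≤ CA * 2 * H := by positivity
            have : 0 ≤ P * g := by positivity
            have e6 : P * (r - s) ^ (-θ) * F = P * g := by rw [hgg]; ring
            rw [e6] at i2
            linarith
          exact le_of_mul_le_mul_left this (by positivity)
        have i4 : ϑ * E t ≤ κ * A * g + ϑ * A * H := by
          calc ϑ * E t ≤ ϑ * (A * (τ ^ (-θ) * (r - s) ^ (-θ) * F + H)) := by gcongr
            _ = _ := by rw [hκ, hgg]; ring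
        have i5 : ϑ * A * H ≤ κ * A * H := by gcongr
        have i6 : A * g = κ * A * g + (4 * P + 2) * g := by rw [← hA1]; ring
        have i7 : A * H = κ * A * H + (4 * P + 2) * H := by rw [← hA1]; ring
        have : 0 ≤ P * g := by positivity
        have : 0 ≤ P * H := by positivity
        rw [mul_add, i6, i7]
        nlinarith
  intro s hs
  obtain ⟨n, hn⟩ := exists_nat_ge (r - s)
  exact key n s hs hn

/-- Caccioppoli constant. -/
noncomputable def cCac (θ CD C2 : ℝ) : ℝ :=
  if hh : 0 < CD ^ 8 * (3 * C2 + 2) ∧ 2 ≤ θ then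
    2 ^ θ * Classical.choose (iter_real (CD ^ 8 * (3 * C2 + 2)) θ hh.1 hh.2) else 1

lemma cCac_pos : 0 < cCac θ CD C2 := by
  unfold cCac
  split_ifs with hh
  · have := (Classical.choose_spec (iter_real (CD ^ 8 * (3 * C2 + 2)) θ hh.1 hh.2)).1
    positivity
  · exact one_pos

lemma HS.cacc (h : HS G K pi θ CD CP C2) (x : V) {r : ℝ} (hr : 0 < r)
    (u : V → ℝ) (l b : ℝ) (b0 : 0 ≤ b)
    (hb : ∀ z ∈ gball G x r, lap K u z ≤ b) (f : V → ℝ) (hf : ∀ z, f z = max (u z - l) 0) :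
    Ener K pi (gball G x (r / 2)) f ≤ cCac θ CD C2 * (r ^ (-θ) * Mass pi (gball G x r) f +
      b * ∑ z ∈ gball G x r, f z * pi z) := by
  have hC2 := h.hC2
  have hCD := h.CD1
  have hθ := h.hθ
  have hh : 0 < CD ^ 8 * (3 * C2 + 2) ∧ 2 ≤ θ := ⟨by positivity, h.hθ⟩
  obtain ⟨A0, hA⟩ := Classical.choose_spec (iter_real (CD ^ 8 * (3 * C2 + 2)) θ hh.1 hh.2)
  unfold cCac
  rw [dif_pos hh]
  set A := Classical.choose (iter_real (CD ^ 8 * (3 * C2 + 2)) θ hh.1 hh.2)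
  have f0 : ∀ z, 0 ≤ f z := fun z => by rw [hf]; exact le_max_right _ _
  have H0 : 0 ≤ b * ∑ z ∈ gball G x r, f z * pi z :=
    mul_nonneg b0 (Finset.sum_nonneg fun z _ => mul_nonneg (f0 z) (h.ppos z).le)
  have M0 := h.Mass_nonneg (gball G x r) f
  have := hA (fun s => Ener K pi (gball G x s) f) (Mass pi (gball G x r) f)
    (b * ∑ z ∈ gball G x r, f z * pi z) r M0 H0
    (fun s hs => (h.Ener_le_Mass _ f).trans (by gcongr; exact h.Mass_mono (gball_mono hs) f))
    (fun s t hst ht => by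
      refine (h.cacc2 x hst u l b b0 (fun z hz => hb z (gball_mono ht hz)) f hf).trans ?_
      have hr : 0 ≤ ((t - s) / 12) ^ (-θ) := Real.rpow_nonneg (by linarith) _
      gcongr
      · exact fun z _ _ => mul_nonneg (f0 z) (h.ppos z).le
      · exact gball_mono ht
      · exact h.Mass_mono (gball_mono ht) f) (r / 2) (by linarith)
  refine this.trans ?_
  have e : r - r / 2 = r * 2⁻¹ := by ring
  rw [e, Real.mul_rpow hr.le (by norm_num), Real.inv_rpow (by norm_num), ← Real.rpow_neg (by norm_num),
    neg_neg]
  have h2 : (1:ℝ) ≤ 2 ^ θ := Real.one_le_rpow (by norm_num) (by linarith)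
  have h3 : b * ∑ z ∈ gball G x r, f z * pi z ≤ 2 ^ θ * (b * ∑ z ∈ gball G x r, f z * pi z) := by
    nlinarith
  calc _ ≤ A * (r ^ (-θ) * 2 ^ θ * Mass pi (gball G x r) f +
      2 ^ θ * (b * ∑ z ∈ gball G x r, f z * pi z)) := by gcongr
    _ = _ := by ring


lemma HS.loc_mass (h : HS G K pi θ CD CP C2) (z : V) {ρ : ℝ} (hρ : 0 < ρ) (f : V → ℝ)
    (hN : ∑ w ∈ (gball G z ρ).filter (fun w => f w ≠ 0), pi w ≤ vol G pi z ρ / 2) :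
    Mass pi (gball G z ρ) f ≤ 2 * CP * ρ ^ θ * Ener K pi (gball G z ρ) f := by
  have hv := h.vol_pos z hρ.le
  have hp := h.poinc z ρ hρ f
  set B := gball G z ρ with hB
  set v := vol G pi z ρ with hvd
  set S := ∑ w ∈ B, f w * pi w with hS
  have e1 : ∑ w ∈ B, (f w - ballAvg G pi z ρ f) ^ 2 * pi w = Mass pi B f - S ^ 2 / v := by
    have : ballAvg G pi z ρ f = S / v := by
      unfold ballAvg; rw [← hvd, ← hB, ← hS]; field_simp
    rw [this]
    have e : ∀ w, (f w - S / v) ^ 2 * pi w =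
      f w ^ 2 * pi w - 2 * (S / v) * (f w * pi w) + (S / v) ^ 2 * pi w := by intro w; ring
    simp only [e, Finset.sum_add_distrib, Finset.sum_sub_distrib, ← Finset.mul_sum]
    rw [← hS]
    have : ∑ w ∈ B, pi w = v := rfl
    rw [this]
    unfold Mass
    field_simp
    ring
  have e2 : S ^ 2 ≤ (v / 2) * Mass pi B f := by
    have : S = ∑ w ∈ B.filter (fun w => f w ≠ 0), f w * pi w := by
      rw [hS, Finset.sum_filter]
      apply Finset.sum_congr rfl; intro w _
      split_ifs with hw
      · rfl
      · push Not at hw; rw [hw, zero_mul]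
    rw [this]
    calc _ ≤ (∑ w ∈ B.filter (fun w => f w ≠ 0), pi w) *
          ∑ w ∈ B.filter (fun w => f w ≠ 0), f w ^ 2 * pi w := by
          apply Finset.sum_sq_le_sum_mul_sum_of_sq_le_mul
          · exact fun w _ => (h.ppos w).le
          · exact fun w _ => mul_nonneg (sq_nonneg _) (h.ppos w).le
          · intro w _; exact le_of_eq (by ring)
      _ ≤ _ := by
          apply mul_le_mul hN _ _ (by positivity)
          · exact h.Mass_mono (Finset.filter_subset _ _) f
          · exact h.Mass_nonneg _ f
  have e3 : S ^ 2 / v ≤ Mass pi B f / 2 := by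
    rw [div_le_iff₀ hv]; linarith
  rw [e1] at hp
  change _ ≤ CP * ρ ^ θ * Ener K pi B f at hp
  linarith

lemma HS.fk (h : HS G K pi θ CD CP C2) (x : V) {r ρ : ℝ} (hρ : 0 < ρ) (hr : ρ ≤ r / 16)
    (f : V → ℝ)
    (hN : ∀ z ∈ gball G x (r / 2),
      ∑ w ∈ (gball G x (r / 2)).filter (fun w => f w ≠ 0), pi w ≤ vol G pi z ρ / 2) :
    Mass pi (gball G x (r / 4)) f ≤
      2 * CP * CD ^ 4 * ρ ^ θ * Ener K pi (gball G x (r / 2)) f := by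
  set T := gball G x (r / 2) with hT
  set S := gball G x (r / 4 + ρ / 2) with hS
  set F : V → ℝ := fun w => ∑ w' ∈ T, (f w - f w') ^ 2 * (pi w * K w w') with hF
  have F0 : ∀ w, 0 ≤ F w := fun w =>
    Finset.sum_nonneg fun w' _ => mul_nonneg (sq_nonneg _) (h.a0 _ _)
  have hCP := h.hCP
  have hCD := h.CD1
  have hsub : ∀ z ∈ S, gball G z (2 * ρ) ⊆ T := by
    intro z hz
    rw [hS, mem_gball] at hz
    apply h.sub; linarith
  have hsub1 : ∀ z ∈ S, gball G z ρ ⊆ T := fun z hz =>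
    (gball_mono (by linarith)).trans (hsub z hz)
  have h1 := h.cover_lower hρ S (gball G x (r / 4)) (fun w => f w ^ 2 * pi w)
    (fun w => mul_nonneg (sq_nonneg _) (h.ppos w).le)
    (fun w hw => by rw [mem_gball] at hw; apply h.sub; linarith)
  have h2 : ∀ z ∈ S, ∑ w ∈ gball G z ρ, f w ^ 2 * pi w ≤
      2 * CP * ρ ^ θ * ∑ w ∈ gball G z (2 * ρ), F w := by
    intro z hz
    refine (h.loc_mass z hρ f ?_).trans ?_
    · refine le_trans ?_ (hN z (gball_mono (by linarith) hz))
      apply Finset.sum_le_sum_of_subset_of_nonneg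
      · exact Finset.filter_subset_filter _ (hsub1 z hz)
      · exact fun w _ _ => (h.ppos w).le
    · apply mul_le_mul_of_nonneg_left _ (by positivity)
      calc Ener K pi (gball G z ρ) f ≤ ∑ w ∈ gball G z ρ, F w := by
            apply Finset.sum_le_sum; intro w _
            apply Finset.sum_le_sum_of_subset_of_nonneg (hsub1 z hz)
            exact fun w' _ _ => mul_nonneg (sq_nonneg _) (h.a0 _ _)
        _ ≤ _ := Finset.sum_le_sum_of_subset_of_nonneg (gball_mono (by linarith)) fun w _ _ => F0 w
  have h3 := h.cover_upper hρ S T F F0 hsub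
  calc Mass pi (gball G x (r / 4)) f
      ≤ CD ^ 2 * ∑ z ∈ S, om G pi ρ z * ∑ w ∈ gball G z ρ, f w ^ 2 * pi w := h1
    _ ≤ CD ^ 2 * ∑ z ∈ S, om G pi ρ z * (2 * CP * ρ ^ θ * ∑ w ∈ gball G z (2 * ρ), F w) := by
        apply mul_le_mul_of_nonneg_left _ (by positivity)
        apply Finset.sum_le_sum; intro z hz
        exact mul_le_mul_of_nonneg_left (h2 z hz) (h.om0 hρ z)
    _ = CD ^ 2 * (2 * CP * ρ ^ θ * ∑ z ∈ S, om G pi ρ z * ∑ w ∈ gball G z (2 * ρ), F w) := by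
        congr 1
        rw [Finset.mul_sum S _ (2 * CP * ρ ^ θ)]
        apply Finset.sum_congr rfl; intro z _; ring
    _ ≤ CD ^ 2 * (2 * CP * ρ ^ θ * (CD ^ 2 * ∑ w ∈ T, F w)) := by gcongr
    _ = _ := by simp only [hF, Ener]; ring

lemma HS.dg_step (h : HS G K pi θ CD CP C2) (x : V) {r : ℝ} (hr : 0 < r) (u : V → ℝ)
    {b : ℝ} (b0 : 0 ≤ b) (hb : ∀ z ∈ gball G x r, lap K u z ≤ b) (l δ : ℝ) (hδ : 0 < δ)
    (j : ℕ) (hj : 4 ≤ j) (hbδ : b * r ^ θ ≤ 2 * δ)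
    (hF : Mass pi (gball G x r) (fun z => max (u z - l) 0) * (2 * CD ^ (j + 1)) ≤
      δ ^ 2 * vol G pi x r) :
    Mass pi (gball G x (r / 4)) (fun z => max (u z - (l + δ)) 0) ≤
      6 * CP * CD ^ 4 * cCac θ CD C2 / 4 ^ j *
        Mass pi (gball G x r) (fun z => max (u z - l) 0) := by
  set f : V → ℝ := fun z => max (u z - l) 0 with hf
  set f' : V → ℝ := fun z => max (u z - (l + δ)) 0 with hf'
  set F := Mass pi (gball G x r) f with hFd
  have hCP := h.hCP
  have hCD := h.CD1
  have hθ := h.hθ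
  have hCc := cCac_pos (θ := θ) (CD := CD) (C2 := C2)
  have F0 : 0 ≤ F := h.Mass_nonneg _ _
  have f0 : ∀ z, 0 ≤ f' z := fun z => le_max_right _ _
  have f1 : ∀ z, f' z ≤ f z := fun z => max_le_max (by linarith) le_rfl
  have f2 : ∀ z, f' z ≠ 0 → δ ≤ f z := by
    intro z hz
    have : 0 < u z - (l + δ) := by
      by_contra hc
      push Not at hc
      exact hz (max_eq_right hc)
    exact le_trans (by linarith) (le_max_left _ _)
  set ρ := r / 2 ^ j with hρ
  have hρ0 : 0 < ρ := by positivity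
  have h16 : (16:ℝ) ≤ 2 ^ j := by
    calc (16:ℝ) = 2 ^ 4 := by norm_num
      _ ≤ 2 ^ j := pow_le_pow_right₀ (by norm_num) hj
  have hρr : ρ ≤ r / 16 := by rw [hρ]; gcongr
  have hN : ∀ z ∈ gball G x (r / 2),
      ∑ w ∈ (gball G x (r / 2)).filter (fun w => f' w ≠ 0), pi w ≤ vol G pi z ρ / 2 := by
    intro z hz
    rw [mem_gball] at hz
    have h1 : vol G pi x r ≤ CD ^ (j + 1) * vol G pi z ρ := by
      apply h.vol_cmp (j + 1) hρ0
      rw [h.comm z x]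
      have : (2:ℝ) ^ (j + 1) * ρ = 2 * r := by rw [hρ, pow_succ]; field_simp
      rw [this]; linarith
    have h2 : δ ^ 2 * ∑ w ∈ (gball G x (r / 2)).filter (fun w => f' w ≠ 0), pi w ≤ F := by
      rw [Finset.mul_sum]
      calc _ ≤ ∑ w ∈ (gball G x (r / 2)).filter (fun w => f' w ≠ 0), f w ^ 2 * pi w := by
            apply Finset.sum_le_sum; intro w hw
            have := f2 w (Finset.mem_filter.mp hw).2
            have := h.ppos w
            gcongr
        _ ≤ _ := by
            apply h.Mass_mono
            exact (Finset.filter_subset _ _).trans (gball_mono (by linarith))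
    have hp : 0 < 2 * CD ^ (j + 1) := by positivity
    have h3 : δ ^ 2 * (CD ^ (j + 1) * ∑ w ∈ (gball G x (r / 2)).filter (fun w => f' w ≠ 0), pi w)
        ≤ δ ^ 2 * (CD ^ (j + 1) * (vol G pi z ρ / 2)) := by
      have h4 := mul_le_mul_of_nonneg_right h2 hp.le
      have h5 := mul_le_mul_of_nonneg_left h1 (sq_nonneg δ)
      nlinarith
    exact le_of_mul_le_mul_left (le_of_mul_le_mul_left h3 (by positivity)) (by positivity)
  have h1 := h.fk x hρ0 hρr f' hN
  have h2 := h.cacc x hr u (l + δ) b b0 hb f' (fun z => rfl)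
  have h3 : Mass pi (gball G x r) f' ≤ F := by
    apply Finset.sum_le_sum; intro z _
    have := h.ppos z
    have := f0 z
    have := f1 z
    gcongr
  have h4 : δ * ∑ z ∈ gball G x r, f' z * pi z ≤ F := by
    rw [Finset.mul_sum]
    apply Finset.sum_le_sum; intro z _
    by_cases hz : f' z = 0
    · rw [hz]; simp only [zero_mul, mul_zero]; exact mul_nonneg (sq_nonneg _) (h.ppos z).le
    · have := f2 z hz
      rw [← mul_assoc, pow_two]
      have := h.ppos z
      have := f0 z
      have := f1 z
      gcongr
  have hrθ : 0 < r ^ θ := by positivity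
  have h5 : b * ∑ z ∈ gball G x r, f' z * pi z ≤ 2 * (r ^ (-θ) * F) := by
    rw [Real.rpow_neg hr.le]
    have s0 : 0 ≤ ∑ z ∈ gball G x r, f' z * pi z :=
      Finset.sum_nonneg fun z _ => mul_nonneg (f0 z) (h.ppos z).le
    set S := ∑ z ∈ gball G x r, f' z * pi z
    have : r ^ θ * (b * S) ≤ r ^ θ * (2 * ((r ^ θ)⁻¹ * F)) := by
      have e : r ^ θ * (2 * ((r ^ θ)⁻¹ * F)) = 2 * F := by field_simp
      rw [e]
      nlinarith [mul_le_mul_of_nonneg_right hbδ s0]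
    exact le_of_mul_le_mul_left this hrθ
  have hrm : 0 ≤ r ^ (-θ) := by positivity
  have h6 : Ener K pi (gball G x (r / 2)) f' ≤ cCac θ CD C2 * (3 * (r ^ (-θ) * F)) := by
    refine h2.trans ?_
    gcongr
    have := mul_le_mul_of_nonneg_left h3 hrm
    linarith
  have h7 : ρ ^ θ * r ^ (-θ) ≤ 1 / 4 ^ j := by
    rw [hρ, Real.div_rpow hr.le (by positivity), Real.rpow_neg hr.le]
    have e : r ^ θ / (2 ^ j) ^ θ * (r ^ θ)⁻¹ = 1 / (2 ^ j) ^ θ := by field_simp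
    rw [e]
    apply one_div_le_one_div_of_le (by positivity)
    calc (4:ℝ) ^ j = (2 ^ j) ^ (2:ℝ) := by
          rw [Real.rpow_two, ← pow_mul, mul_comm, pow_mul]; norm_num
      _ ≤ _ := Real.rpow_le_rpow_of_exponent_le (by linarith) hθ
  calc _ ≤ 2 * CP * CD ^ 4 * ρ ^ θ * Ener K pi (gball G x (r / 2)) f' := h1
    _ ≤ 2 * CP * CD ^ 4 * ρ ^ θ * (cCac θ CD C2 * (3 * (r ^ (-θ) * F))) := by gcongr
    _ = 6 * CP * CD ^ 4 * cCac θ CD C2 * F * (ρ ^ θ * r ^ (-θ)) := by ring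
    _ ≤ 6 * CP * CD ^ 4 * cCac θ CD C2 * F * (1 / 4 ^ j) := by gcongr
    _ = _ := by ring

/-- index constant -/
noncomputable def cJ (θ CD CP C2 : ℝ) : ℕ :=
  max 4 ⌈4 * CD * (6 * CP * CD ^ 4 * cCac θ CD C2) * CD ^ 2⌉₊

/-- small constant -/
noncomputable def cY (θ CD CP C2 : ℝ) : ℝ := 1 / (8 * CD ^ (cJ θ CD CP C2 + 1))

lemma HS.mv (h : HS G K pi θ CD CP C2) (x : V) {r : ℝ} (hr : 0 < r) (u : V → ℝ)
    {b M : ℝ} (b0 : 0 ≤ b) (hb : ∀ z ∈ gball G x r, lap K u z ≤ b) (hM : 0 < M)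
    (hbM : b * r ^ θ ≤ M)
    (hF : Mass pi (gball G x r) (fun z => max (u z) 0) ≤
      cY θ CD CP C2 * M ^ 2 * vol G pi x r) : u x ≤ 2 * M := by
  set j0 := cJ θ CD CP C2 with hj0
  set y0 := cY θ CD CP C2 with hy0
  have hCP := h.hCP
  have hCD := h.CD1
  have hθ := h.hθ
  have hCc := cCac_pos (θ := θ) (CD := CD) (C2 := C2)
  have hy : y0 * (8 * CD ^ (j0 + 1)) = 1 := by
    rw [hy0, cY, ← hj0]; field_simp
  have hypos : 0 < y0 := by rw [hy0, cY]; positivity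
  set C := 6 * CP * CD ^ 4 * cCac θ CD C2 with hC
  have hCpos : 0 < C := by positivity
  have hjC : 4 * CD * C * CD ^ 2 ≤ 4 ^ j0 := by
    calc 4 * CD * C * CD ^ 2 ≤ (⌈4 * CD * C * CD ^ 2⌉₊ : ℝ) := Nat.le_ceil _
      _ ≤ (j0 : ℝ) := by exact_mod_cast le_max_right _ _
      _ ≤ 4 ^ j0 := by exact_mod_cast (Nat.lt_pow_self (by norm_num)).le
  have hj4 : 4 ≤ j0 := le_max_left _ _
  have key : ∀ k : ℕ, Mass pi (gball G x (r / 4 ^ k)) (fun z => max (u z - M * (1 - 1 / 2 ^ k)) 0)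
      * (4 * CD) ^ k ≤ y0 * M ^ 2 * vol G pi x (r / 4 ^ k) := by
    intro k
    induction k with
    | zero => simpa using hF
    | succ k ih =>
      have hrk : 0 < r / 4 ^ k := by positivity
      set F := Mass pi (gball G x (r / 4 ^ k)) (fun z => max (u z - M * (1 - 1 / 2 ^ k)) 0)
        with hFd
      have F0 : 0 ≤ F := h.Mass_nonneg _ _
      have hs := h.dg_step x hrk u b0
        (fun z hz => hb z (gball_mono (div_le_self hr.le (one_le_pow₀ (by norm_num))) hz))
        (M * (1 - 1 / 2 ^ k)) (M / 2 ^ (k + 1)) (by positivity) (j0 + k) (by omega)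
        (by
          rw [Real.div_rpow hr.le (by positivity)]
          have h1 : (2:ℝ) ^ k ≤ (4 ^ k) ^ θ := by
            calc (2:ℝ) ^ k ≤ 4 ^ k := pow_le_pow_left₀ (by norm_num) (by norm_num) _
              _ = (4 ^ k) ^ (1:ℝ) := by rw [Real.rpow_one]
              _ ≤ _ := Real.rpow_le_rpow_of_exponent_le (one_le_pow₀ (by norm_num)) (by linarith)
          calc b * (r ^ θ / (4 ^ k) ^ θ) = (b * r ^ θ) / (4 ^ k) ^ θ := by ring
            _ ≤ M / 2 ^ k := by gcongr
            _ = 2 * (M / 2 ^ (k + 1)) := by rw [pow_succ]; field_simp)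
        (by
          rw [← hFd]
          have e : (M / 2 ^ (k + 1)) ^ 2 * vol G pi x (r / 4 ^ k) =
              M ^ 2 * vol G pi x (r / 4 ^ k) / (4 * 4 ^ k) := by
            rw [div_pow, ← pow_mul, mul_comm (k + 1) 2, pow_mul, pow_succ]; norm_num
            field_simp
            ring
          rw [e, le_div_iff₀ (by positivity)]
          calc F * (2 * CD ^ (j0 + k + 1)) * (4 * 4 ^ k)
              = (F * (4 * CD) ^ k) * (8 * CD ^ (j0 + 1)) := by
                rw [mul_pow]; ring
            _ ≤ (y0 * M ^ 2 * vol G pi x (r / 4 ^ k)) * (8 * CD ^ (j0 + 1)) := by gcongr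
            _ = (y0 * (8 * CD ^ (j0 + 1))) * (M ^ 2 * vol G pi x (r / 4 ^ k)) := by ring
            _ = _ := by rw [hy, one_mul])
      rw [← hFd, ← hC] at hs
      have e1 : r / 4 ^ k / 4 = r / 4 ^ (k + 1) := by rw [pow_succ]; field_simp
      have e2 : M * (1 - 1 / 2 ^ k) + M / 2 ^ (k + 1) = M * (1 - 1 / 2 ^ (k + 1)) := by
        rw [pow_succ]; field_simp; ring
      rw [e1, e2] at hs
      have hv : vol G pi x (r / 4 ^ k) ≤ CD ^ 2 * vol G pi x (r / 4 ^ (k + 1)) := by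
        apply h.vol_cmp 2 (by positivity)
        rw [← e1]; simp; apply le_of_eq; field_simp; norm_num
      calc _ ≤ C / 4 ^ (j0 + k) * F * (4 * CD) ^ (k + 1) := by gcongr
        _ = C * (4 * CD) / 4 ^ (j0 + k) * (F * (4 * CD) ^ k) := by ring
        _ ≤ C * (4 * CD) / 4 ^ (j0 + k) *
            (y0 * M ^ 2 * (CD ^ 2 * vol G pi x (r / 4 ^ (k + 1)))) := by
            apply mul_le_mul_of_nonneg_left _ (by positivity)
            exact ih.trans (by gcongr)
        _ = (4 * CD * C * CD ^ 2) / 4 ^ (j0 + k) * (y0 * M ^ 2 * vol G pi x (r / 4 ^ (k + 1))) := by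
            ring
        _ ≤ 1 * (y0 * M ^ 2 * vol G pi x (r / 4 ^ (k + 1))) := by
            apply mul_le_mul_of_nonneg_right
            · rw [div_le_one (by positivity)]
              refine hjC.trans ?_
              exact pow_le_pow_right₀ (by norm_num) (by omega)
            · have := h.vol_pos x (r := r / 4 ^ (k + 1)) (by positivity)
              positivity
        _ = _ := one_mul _
  obtain ⟨k, hk⟩ := pow_unbounded_of_one_lt r (show (1:ℝ) < 4 by norm_num)
  have hk1 : r / 4 ^ k < 1 := by rw [div_lt_one (by positivity)]; exact hk
  have hball : gball G x (r / 4 ^ k) = {x} := by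
    ext w
    rw [mem_gball, Finset.mem_singleton]
    constructor
    · intro hw
      have : (G.dist x w : ℝ) < 1 := by linarith
      have : G.dist x w = 0 := by
        have : G.dist x w < 1 := by exact_mod_cast this
        omega
      exact ((h.conn.dist_eq_zero_iff).mp this).symm
    · rintro rfl
      simp; positivity
  have := key k
  rw [Mass, vol, hball] at this
  simp only [Finset.sum_singleton] at this
  have hpx := h.ppos x
  have hone : (1:ℝ) ≤ (4 * CD) ^ k := one_le_pow₀ (by linarith)
  have hy1 : y0 ≤ 1 := by
    have : (1:ℝ) ≤ CD ^ (j0 + 1) := one_le_pow₀ hCD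
    nlinarith
  set m := max (u x - M * (1 - 1 / 2 ^ k)) 0 with hm
  have h1 : m ^ 2 ≤ M ^ 2 := by
    have a1 : m ^ 2 * pi x ≤ y0 * M ^ 2 * pi x := by
      refine le_trans ?_ this
      apply le_mul_of_one_le_right (by positivity) hone
    have a2 := le_of_mul_le_mul_right a1 hpx
    nlinarith [sq_nonneg M]
  have h2 : m ≤ M := by
    apply le_of_sq_le_sq h1 hM.le
  have h3 := le_max_left (u x - M * (1 - 1 / 2 ^ k)) 0
  rw [← hm] at h3
  have : M * (1 - 1 / 2 ^ k) ≤ M := by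
    have : 0 < (1:ℝ) / 2 ^ k := by positivity
    nlinarith
  linarith

/-- mean value constant -/
noncomputable def cMV (θ CD CP C2 : ℝ) : ℝ := 2 / √(cY θ CD CP C2)

lemma lap_sub_const (h : HS G K pi θ CD CP C2) (u : V → ℝ) (c : ℝ) (z : V) :
    lap K (fun w => u w - c) z = lap K u z := by
  simp only [lap, mul_sub, Finset.sum_sub_distrib, ← Finset.sum_mul, h.K1]; ring

lemma lap_const_sub (h : HS G K pi θ CD CP C2) (u : V → ℝ) (c : ℝ) (z : V) :
    lap K (fun w => c - u w) z = - lap K u z := by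
  simp only [lap, mul_sub, Finset.sum_sub_distrib, ← Finset.sum_mul, h.K1]; ring

lemma HS.cY_pos (h : HS G K pi θ CD CP C2) : 0 < cY θ CD CP C2 := by
  have := h.CD1
  unfold cY; positivity

lemma HS.cMV_pos (h : HS G K pi θ CD CP C2) : 0 < cMV θ CD CP C2 := by
  have := h.cY_pos
  unfold cMV; positivity

lemma HS.mv2 (h : HS G K pi θ CD CP C2) (x : V) {r : ℝ} (hr : 0 < r) (u : V → ℝ) (c : ℝ)
    {b N : ℝ} (b0 : 0 ≤ b) (hb : ∀ z ∈ gball G x r, |lap K u z| ≤ b) (hN : 0 ≤ N)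
    (hbM : b * r ^ θ ≤ N)
    (hF : Mass pi (gball G x r) (fun z => u z - c) ≤ N ^ 2 * vol G pi x r) :
    |u x - c| ≤ cMV θ CD CP C2 * N := by
  have hy := h.cY_pos
  have hMV := h.cMV_pos
  have hv := h.vol_pos x hr.le
  have key : ∀ N' : ℝ, N < N' → |u x - c| ≤ cMV θ CD CP C2 * N' := by
    intro N' hN'
    have hy1 : cY θ CD CP C2 ≤ 1 := by
      have := h.CD1
      have : (1:ℝ) ≤ CD ^ (cJ θ CD CP C2 + 1) := one_le_pow₀ h.CD1
      unfold cY
      rw [div_le_one (by positivity)]; linarith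
    have hs0 : 0 < √(cY θ CD CP C2) := Real.sqrt_pos.mpr hy
    have hs1 : √(cY θ CD CP C2) ≤ 1 := Real.sqrt_le_one.mpr hy1
    have N0 : 0 < N' := by linarith
    have e : cMV θ CD CP C2 * N' = 2 * (N' / √(cY θ CD CP C2)) := by unfold cMV; ring
    have hM : 0 < N' / √(cY θ CD CP C2) := by positivity
    have hNM : N' ≤ N' / √(cY θ CD CP C2) := by
      rw [le_div_iff₀ hs0]; nlinarith
    have e2 : cY θ CD CP C2 * (N' / √(cY θ CD CP C2)) ^ 2 = N' ^ 2 := by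
      rw [div_pow, Real.sq_sqrt hy.le]; field_simp
    have hF' : Mass pi (gball G x r) (fun z => u z - c) ≤ N' ^ 2 * vol G pi x r := by
      refine hF.trans ?_
      gcongr
    rw [e, abs_le]
    constructor
    · have := h.mv x hr (fun w => c - u w) b0
        (fun z hz => by rw [lap_const_sub h]; linarith [neg_abs_le (lap K u z), hb z hz]) hM (by linarith)
        (by
          rw [e2]
          refine le_trans ?_ hF'
          apply Finset.sum_le_sum; intro z _
          apply mul_le_mul_of_nonneg_right _ (h.ppos z).le
          beta_reduce
          rcases le_total (c - u z) 0 with hz | hz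
          · rw [max_eq_right hz]; nlinarith
          · rw [max_eq_left hz]; nlinarith)
      linarith
    · have := h.mv x hr (fun w => u w - c) b0
        (fun z hz => by rw [lap_sub_const h]; linarith [le_abs_self (lap K u z), hb z hz]) hM (by linarith)
        (by
          rw [e2]
          refine le_trans ?_ hF'
          apply Finset.sum_le_sum; intro z _
          apply mul_le_mul_of_nonneg_right _ (h.ppos z).le
          beta_reduce
          rcases le_total (u z - c) 0 with hz | hz
          · rw [max_eq_right hz]; nlinarith
          · rw [max_eq_left hz])
      linarith
  by_contra hc
  push Not at hc
  have h1 : N < |u x - c| / cMV θ CD CP C2 := by rw [lt_div_iff₀ hMV]; linarith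
  obtain ⟨N', h2, h3⟩ := exists_between h1
  have := key N' h2
  rw [lt_div_iff₀ hMV] at h3
  linarith


lemma HS.sum_K (h : HS G K pi θ CD CP C2) (f : V → ℝ) :
    ∑ x, pi x * ∑ y, K x y * f y = ∑ y, f y * pi y := by
  simp only [Finset.mul_sum]
  rw [Finset.sum_comm]
  apply Finset.sum_congr rfl; intro y _
  have : ∀ x, pi x * (K x y * f y) = f y * pi y * K y x := by
    intro x
    calc pi x * (K x y * f y) = (pi x * K x y) * f y := by ring
      _ = (pi y * K y x) * f y := by rw [h.rev]
      _ = _ := by ring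
  simp only [this, ← Finset.mul_sum, h.K1, mul_one]

lemma HS.contr_pt (h : HS G K pi θ CD CP C2) (f : V → ℝ) (x : V) :
    (∑ y, K x y * f y) ^ 2 ≤ ∑ y, K x y * f y ^ 2 - 1 / 2 * ∑ y, K x y * (f x - f y) ^ 2 := by
  set S := ∑ y, K x y * (f y - f x) with hS
  set Q := ∑ y, K x y * (f x - f y) ^ 2 with hQ
  have Q0 : 0 ≤ Q := Finset.sum_nonneg fun y _ => mul_nonneg (h.K0 x y) (sq_nonneg _)
  have e1 : ∑ y, K x y * f y = f x + S := by
    simp only [hS, mul_sub, Finset.sum_sub_distrib, ← Finset.sum_mul, h.K1]; ring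
  have e2 : ∑ y, K x y * f y ^ 2 = f x ^ 2 + 2 * f x * S + Q := by
    have : ∀ y, K x y * f y ^ 2 = K x y * f x ^ 2 + 2 * f x * (K x y * (f y - f x)) +
      K x y * (f x - f y) ^ 2 := by intro y; ring
    simp only [this, Finset.sum_add_distrib, ← Finset.mul_sum, ← Finset.sum_mul, h.K1]
    rw [← hS, ← hQ]; ring
  have e3 : S ^ 2 ≤ 1 / 2 * Q := by
    have : S = ∑ y ∈ univ.erase x, K x y * (f y - f x) := by
      rw [hS, ← Finset.add_sum_erase _ _ (Finset.mem_univ x)]; simp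
    rw [this]
    have hsum : ∑ y ∈ univ.erase x, K x y ≤ 1 / 2 := by
      have := Finset.add_sum_erase univ (fun y => K x y) (Finset.mem_univ x)
      have h1 := h.K1 x
      have h2 := h.lazy x
      linarith
    calc _ ≤ (∑ y ∈ univ.erase x, K x y) * ∑ y ∈ univ.erase x, K x y * (f x - f y) ^ 2 := by
          apply Finset.sum_sq_le_sum_mul_sum_of_sq_le_mul
          · exact fun y _ => h.K0 x y
          · exact fun y _ => mul_nonneg (h.K0 x y) (sq_nonneg _)
          · intro y _; exact le_of_eq (by ring)
      _ ≤ 1 / 2 * Q := by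
          apply mul_le_mul hsum _ _ (by norm_num)
          · exact Finset.sum_le_sum_of_subset_of_nonneg (Finset.erase_subset _ _)
              fun y _ _ => mul_nonneg (h.K0 x y) (sq_nonneg _)
          · exact Finset.sum_nonneg fun y _ => mul_nonneg (h.K0 x y) (sq_nonneg _)
  rw [e1, e2]
  nlinarith

lemma HS.contr (h : HS G K pi θ CD CP C2) (f : V → ℝ) :
    Mass pi univ (fun x => ∑ y, K x y * f y) ≤ Mass pi univ f - 1 / 2 * Ener K pi univ f := by
  calc Mass pi univ (fun x => ∑ y, K x y * f y)
      ≤ ∑ x, (∑ y, K x y * f y ^ 2 - 1 / 2 * ∑ y, K x y * (f x - f y) ^ 2) * pi x :=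
        Finset.sum_le_sum fun x _ => mul_le_mul_of_nonneg_right (h.contr_pt f x) (h.ppos x).le
    _ = ∑ x, pi x * ∑ y, K x y * f y ^ 2 - 1 / 2 * Ener K pi univ f := by
        unfold Ener
        rw [Finset.mul_sum, ← Finset.sum_sub_distrib]
        apply Finset.sum_congr rfl; intro x _
        have : ∑ y, (f x - f y) ^ 2 * (pi x * K x y) = pi x * ∑ y, K x y * (f x - f y) ^ 2 := by
          rw [Finset.mul_sum]; apply Finset.sum_congr rfl; intro y _; ring
        rw [this]; ring
    _ = _ := by rw [h.sum_K (fun y => f y ^ 2)]; rfl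

lemma HS.exists_gap (h : HS G K pi θ CD CP C2) : ∃ q : ℝ, 0 ≤ q ∧ q < 1 ∧
    ∀ f : V → ℝ, ∑ x, f x * pi x = 0 →
      Mass pi univ (fun x => ∑ y, K x y * f y) ≤ q * Mass pi univ f := by
  obtain ⟨x0⟩ := h.conn.nonempty
  set r : ℝ := ∑ y, (G.dist x0 y : ℝ) + 1 with hr
  have hr0 : 0 < r := by positivity
  have hball : gball G x0 r = univ := by
    ext y
    simp only [mem_gball, Finset.mem_univ, iff_true]
    have := Finset.single_le_sum (f := fun y => (G.dist x0 y : ℝ)) (fun y _ => by positivity)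
      (Finset.mem_univ y)
    linarith
  have hCP := h.hCP
  set P := CP * r ^ θ with hP
  have P0 : 0 < P := by positivity
  refine ⟨max 0 (1 - 1 / (2 * P)), le_max_left _ _, max_lt one_pos ?_, ?_⟩
  · have : 0 < 1 / (2 * P) := by positivity
    linarith
  · intro f hf
    have hp := h.poinc x0 r hr0 f
    have ha : ballAvg G pi x0 r f = 0 := by
      unfold ballAvg; rw [hball, hf, mul_zero]
    rw [ha, hball] at hp
    simp only [sub_zero] at hp
    change Mass pi univ f ≤ P * Ener K pi univ f at hp
    have hc := h.contr f
    have M0 := h.Mass_nonneg univ f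
    have h1 : 1 / (2 * P) * Mass pi univ f ≤ 1 / 2 * Ener K pi univ f := by
      rw [div_mul_eq_mul_div, div_le_iff₀ (by positivity)]; linarith
    have h2 := mul_le_mul_of_nonneg_right (le_max_right 0 (1 - 1 / (2 * P))) M0
    linarith

lemma HS.kn_succ (_h : HS G K pi θ CD CP C2) (n : ℕ) (x y : V) :
    knorm K pi (n + 1) x y = ∑ z, K x z * knorm K pi n z y := by
  unfold knorm
  rw [matpow, Finset.sum_div]
  apply Finset.sum_congr rfl; intro z _; ring

lemma HS.kn_succ' (h : HS G K pi θ CD CP C2) (n : ℕ) (x y : V) :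
    knorm K pi (n + 1) x y - 1 = ∑ z, K x z * (knorm K pi n z y - 1) := by
  rw [h.kn_succ]
  simp only [mul_sub, Finset.sum_sub_distrib, mul_one, h.K1]

lemma HS.kn_mean (h : HS G K pi θ CD CP C2) (n : ℕ) (y : V) :
    ∑ x, (knorm K pi n x y - 1) * pi x = 0 := by
  induction n with
  | zero =>
    have := (h.ppos y).ne'
    simp only [knorm, matpow, sub_mul, Finset.sum_sub_distrib, one_mul, h.psum]
    have : ∀ x, (if x = y then (1:ℝ) else 0) / pi y * pi x = if x = y then 1 else 0 := by
      intro x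
      split_ifs with hx
      · subst hx; field_simp
      · simp
    simp [this]
  | succ n ih =>
    rw [← ih, ← h.sum_K (fun x => knorm K pi n x y - 1)]
    apply Finset.sum_congr rfl; intro x _
    rw [h.kn_succ', mul_comm]

lemma HS.green_summable (h : HS G K pi θ CD CP C2) (x y : V) :
    Summable fun n : ℕ => knorm K pi n x y - 1 := by
  obtain ⟨q, q0, q1, hq⟩ := h.exists_gap
  set M := Mass pi univ (fun z => knorm K pi 0 z y - 1) with hM
  have M0 : 0 ≤ M := h.Mass_nonneg _ _
  have hb : ∀ n : ℕ, Mass pi univ (fun z => knorm K pi n z y - 1) ≤ q ^ n * M := by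
    intro n
    induction n with
    | zero => simp [hM]
    | succ n ih =>
      have := hq (fun z => knorm K pi n z y - 1) (h.kn_mean n y)
      simp only [← h.kn_succ'] at this
      refine this.trans ?_
      rw [pow_succ', mul_assoc]
      gcongr
  have hpx := h.ppos x
  have hpt : ∀ n : ℕ, ‖knorm K pi n x y - 1‖ ≤ √(M / pi x) * (√q) ^ n := by
    intro n
    have h1 : (knorm K pi n x y - 1) ^ 2 * pi x ≤ q ^ n * M :=
      le_trans (Finset.single_le_sum (f := fun z => (knorm K pi n z y - 1) ^ 2 * pi z)
        (fun z _ => mul_nonneg (sq_nonneg _) (h.ppos z).le) (Finset.mem_univ x)) (hb n)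
    rw [Real.norm_eq_abs]
    apply abs_le_of_sq_le_sq _ (by positivity)
    rw [mul_pow, Real.sq_sqrt (by positivity), ← pow_mul, mul_comm n 2, pow_mul, Real.sq_sqrt q0,
      div_mul_eq_mul_div, le_div_iff₀ hpx]
    linarith
  refine Summable.of_norm_bounded ?_ hpt
  apply Summable.mul_left
  apply summable_geometric_of_lt_one (by positivity)
  rw [Real.sqrt_lt' one_pos]; simpa using q1

lemma HS.green_lap (h : HS G K pi θ CD CP C2) (z y : V) :
    lap K (fun x => green K pi x y) z = (if z = y then 1 / pi y else 0) - 1 := by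
  unfold lap green
  beta_reduce
  rw [(h.green_summable z y).tsum_eq_zero_add]
  simp only [h.kn_succ']
  have : ∑' n : ℕ, ∑ w, K z w * (knorm K pi n w y - 1) =
      ∑ w, K z w * ∑' n : ℕ, (knorm K pi n w y - 1) := by
    rw [Summable.tsum_finsetSum (fun w _ => (h.green_summable w y).mul_left _)]
    apply Finset.sum_congr rfl; intro w _
    rw [tsum_mul_left]
  rw [this, add_sub_cancel_right]
  simp only [knorm, matpow]
  split_ifs <;> simp

lemma HS.green_mean (h : HS G K pi θ CD CP C2) (y : V) :
    ∑ x, green K pi x y * pi x = 0 := by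
  unfold green
  simp only [← tsum_mul_right]
  rw [← Summable.tsum_finsetSum (fun w _ => (h.green_summable w y).mul_right _)]
  simp [h.kn_mean]

/-- inner product -/
noncomputable def inn (pi : V → ℝ) (φ ψ : V → ℝ) : ℝ := ∑ x, φ x * ψ x * pi x

lemma inn_comm (φ ψ : V → ℝ) : inn pi φ ψ = inn pi ψ φ := by
  unfold inn; apply Finset.sum_congr rfl; intro x _; ring

lemma HS.lap_self (h : HS G K pi θ CD CP C2) (u v : V → ℝ) :
    inn pi v (lap K u) = inn pi u (lap K v) := by
  have e1 := h.green_id u v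
  have e2 := h.green_id v u
  have : ∑ z, ∑ w, (u z - u w) * (v z - v w) * (pi z * K z w) =
      ∑ z, ∑ w, (v z - v w) * (u z - u w) * (pi z * K z w) := by
    apply Finset.sum_congr rfl; intro z _
    apply Finset.sum_congr rfl; intro w _; ring
  rw [this, e2] at e1
  have e3 : ∀ a b : V → ℝ, inn pi a b = ∑ z, a z * pi z * b z := by
    intro a b; unfold inn; apply Finset.sum_congr rfl; intro x _; ring
  rw [e3, e3]; linarith

lemma HS.green_symm (h : HS G K pi θ CD CP C2) (x y : V) : green K pi x y = green K pi y x := by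
  have key : ∀ x y, inn pi (fun z => green K pi z x) (lap K (fun z => green K pi z y)) =
      green K pi y x := by
    intro x y
    unfold inn
    simp only [h.green_lap, mul_sub, sub_mul, Finset.sum_sub_distrib, mul_one, h.green_mean]
    rw [Finset.sum_eq_single y]
    · have := (h.ppos y).ne'
      simp; field_simp
    · intro z _ hz; simp [hz]
    · simp
  rw [← key y x, h.lap_self, key]

/-- Green operator -/
noncomputable def gO (K : V → V → ℝ) (pi : V → ℝ) (φ : V → ℝ) (x : V) : ℝ :=
  ∑ y, green K pi x y * (φ y * pi y)

lemma HS.gO_lap (h : HS G K pi θ CD CP C2) (φ : V → ℝ) (z : V) :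
    lap K (gO K pi φ) z = φ z - ∑ y, φ y * pi y := by
  have : lap K (gO K pi φ) z = ∑ y, lap K (fun x => green K pi x y) z * (φ y * pi y) := by
    unfold lap gO
    simp only [sub_mul, Finset.sum_sub_distrib, Finset.sum_mul, Finset.mul_sum]
    congr 1
    rw [Finset.sum_comm]
    apply Finset.sum_congr rfl; intro y _
    apply Finset.sum_congr rfl; intro w _; ring
  rw [this]
  simp only [h.green_lap, sub_mul, Finset.sum_sub_distrib, one_mul]
  congr 1
  rw [Finset.sum_eq_single z]
  · have := (h.ppos z).ne'
    simp; field_simp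
  · intro y _ hy; simp [hy.symm]
  · simp

lemma HS.gO_symm (h : HS G K pi θ CD CP C2) (φ ψ : V → ℝ) :
    inn pi φ (gO K pi ψ) = inn pi ψ (gO K pi φ) := by
  unfold inn gO
  simp only [Finset.mul_sum, Finset.sum_mul]
  rw [Finset.sum_comm]
  apply Finset.sum_congr rfl; intro y _
  apply Finset.sum_congr rfl; intro x _
  rw [h.green_symm x y]; ring

lemma gO_sub (φ ψ : V → ℝ) (x : V) :
    gO K pi (fun z => φ z - ψ z) x = gO K pi φ x - gO K pi ψ x := by
  unfold gO
  rw [← Finset.sum_sub_distrib]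
  apply Finset.sum_congr rfl; intro y _; ring

lemma HS.gO_const (h : HS G K pi θ CD CP C2) (c : ℝ) (x : V) :
    gO K pi (fun _ => c) x = 0 := by
  unfold gO
  have : ∀ y, green K pi x y * (c * pi y) = c * (green K pi y x * pi y) := by
    intro y; rw [h.green_symm x y]; ring
  simp only [this, ← Finset.mul_sum, h.green_mean, mul_zero]

lemma inn_sub_left (a b c : V → ℝ) : inn pi (fun z => a z - b z) c = inn pi a c - inn pi b c := by
  unfold inn; rw [← Finset.sum_sub_distrib]; apply Finset.sum_congr rfl; intro x _; ring

lemma inn_sub_right (a b c : V → ℝ) : inn pi a (fun z => b z - c z) = inn pi a b - inn pi a c := by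
  unfold inn; rw [← Finset.sum_sub_distrib]; apply Finset.sum_congr rfl; intro x _; ring

lemma HS.Ener_gO (h : HS G K pi θ CD CP C2) (φ : V → ℝ) (h0 : ∑ y, φ y * pi y = 0) :
    Ener K pi univ (gO K pi φ) = 2 * inn pi φ (gO K pi φ) := by
  have e := h.green_id (gO K pi φ) (gO K pi φ)
  simp only [h.gO_lap, h0, sub_zero] at e
  unfold Ener inn
  rw [show ∑ z, φ z * gO K pi φ z * pi z = ∑ z, gO K pi φ z * pi z * φ z by
    apply Finset.sum_congr rfl; intro z _; ring, ← e]
  apply Finset.sum_congr rfl; intro z _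
  apply Finset.sum_congr rfl; intro w _; ring


lemma HS.inn_sq_le (h : HS G K pi θ CD CP C2) (φ u : V → ℝ) (B : Finset V)
    (hs : ∀ z, z ∉ B → φ z = 0) : (inn pi φ u) ^ 2 ≤ Mass pi univ φ * Mass pi B u := by
  have e1 : inn pi φ u = ∑ z ∈ B, φ z * u z * pi z := by
    unfold inn
    symm
    apply Finset.sum_subset (Finset.subset_univ B)
    intro z _ hz; rw [hs z hz]; ring
  rw [e1]
  calc _ ≤ (∑ z ∈ B, φ z ^ 2 * pi z) * ∑ z ∈ B, u z ^ 2 * pi z := by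
        apply Finset.sum_sq_le_sum_mul_sum_of_sq_le_mul
        · exact fun z _ => mul_nonneg (sq_nonneg _) (h.ppos z).le
        · exact fun z _ => mul_nonneg (sq_nonneg _) (h.ppos z).le
        · intro z _; exact le_of_eq (by ring)
    _ ≤ _ := mul_le_mul_of_nonneg_right (h.Mass_mono (Finset.subset_univ B) φ)
        (h.Mass_nonneg B u)

lemma inn_shift (φ u : V → ℝ) (c : ℝ) (h0 : ∑ y, φ y * pi y = 0) :
    inn pi φ (fun z => u z - c) = inn pi φ u := by
  have : inn pi φ (fun z => u z - c) = inn pi φ u - c * ∑ y, φ y * pi y := by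
    unfold inn
    rw [Finset.mul_sum, ← Finset.sum_sub_distrib]
    apply Finset.sum_congr rfl; intro z _; ring
  rw [this, h0]; ring

lemma HS.lemP (h : HS G K pi θ CD CP C2) (x : V) {R : ℝ} (hR : 0 < R) (φ : V → ℝ)
    (h0 : ∑ y, φ y * pi y = 0) (hs : ∀ z, z ∉ gball G x R → φ z = 0) :
    Mass pi (gball G x R) (fun z => gO K pi φ z - ballAvg G pi x R (gO K pi φ)) ≤
      (2 * CP * R ^ θ) ^ 2 * Mass pi univ φ := by
  set u := gO K pi φ with hu
  set c := ballAvg G pi x R u with hc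
  set X := Mass pi (gball G x R) (fun z => u z - c) with hX
  have hCP := h.hCP
  have X0 : 0 ≤ X := h.Mass_nonneg _ _
  have hp : X ≤ CP * R ^ θ * Ener K pi (gball G x R) u := h.poinc x R hR u
  have hE := h.Ener_mono (Finset.subset_univ (gball G x R)) u
  rw [hu, h.Ener_gO φ h0, ← hu, ← inn_shift φ u c h0] at hE
  set Y := inn pi φ (fun z => u z - c) with hY
  have hYX : Y ^ 2 ≤ Mass pi univ φ * X := h.inn_sq_le φ _ _ hs
  set P := CP * R ^ θ with hP
  have P0 : 0 < P := by positivity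
  have hXY : X ≤ 2 * P * Y := by
    refine hp.trans ?_
    nlinarith
  have e : (2 * CP * R ^ θ) ^ 2 = 4 * P ^ 2 := by rw [hP]; ring
  rw [e]
  rcases X0.eq_or_lt with h1 | h1
  · rw [← h1]; have := h.Mass_nonneg univ φ; positivity
  · have : X * X ≤ (4 * P ^ 2 * Mass pi univ φ) * X := by
      calc X * X ≤ (2 * P * Y) * (2 * P * Y) := mul_self_le_mul_self X0 hXY
        _ = 4 * P ^ 2 * Y ^ 2 := by ring
        _ ≤ 4 * P ^ 2 * (Mass pi univ φ * X) := by gcongr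
        _ = _ := by ring
    exact le_of_mul_le_mul_right this h1

/-- constant -/
noncomputable def cS (θ CD CP C2 : ℝ) (k : ℕ) : ℝ :=
  cMV θ CD CP C2 * (1 + 2 * CP * CD ^ (k + 1))

lemma HS.cS_pos (h : HS G K pi θ CD CP C2) (k : ℕ) : 0 < cS θ CD CP C2 k := by
  have := h.cMV_pos
  have := h.hCP
  have := h.CD1
  unfold cS; positivity

lemma HS.lemS (h : HS G K pi θ CD CP C2) (x z : V) {R s N : ℝ} (k : ℕ) (hs0 : 0 < s)
    (hN : 0 ≤ N) (φ : V → ℝ)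
    (h0 : ∑ y, φ y * pi y = 0) (hs : ∀ w, w ∉ gball G x R → φ w = 0)
    (hφ : Mass pi univ φ ≤ N ^ 2 * vol G pi x R)
    (hz : (G.dist x z : ℝ) + s ≤ R) (hRs : R ≤ 2 ^ k * s)
    (hzN : ∀ w ∈ gball G z s, |φ w| ≤ N) :
    |gO K pi φ z - ballAvg G pi x R (gO K pi φ)| ≤ cS θ CD CP C2 k * (N * R ^ θ) := by
  have hd : (0:ℝ) ≤ G.dist x z := by positivity
  have hR : 0 < R := by linarith
  have hCP := h.hCP
  have hCD := h.CD1
  have hθ := h.hθ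
  have hP := h.lemP x hR φ h0 hs
  set c := ballAvg G pi x R (gO K pi φ) with hc
  have hv := h.vol_pos z hs0.le
  have hvx : vol G pi x R ≤ CD ^ (k + 1) * vol G pi z s := by
    apply h.vol_cmp (k + 1) hs0
    rw [h.comm z x, pow_succ]; linarith
  have hRθ : 0 < R ^ θ := by positivity
  have hCk : (1:ℝ) ≤ CD ^ (k + 1) := one_le_pow₀ hCD
  have := h.mv2 z hs0 (gO K pi φ) c hN
    (fun w hw => by rw [h.gO_lap, h0, sub_zero]; exact hzN w hw)
    (N := N * R ^ θ * (1 + 2 * CP * CD ^ (k + 1))) (by positivity)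
    (by
      have h1 : s ^ θ ≤ R ^ θ := Real.rpow_le_rpow hs0.le (by linarith) (by linarith)
      calc N * s ^ θ ≤ N * R ^ θ := by gcongr
        _ ≤ N * R ^ θ * (1 + 2 * CP * CD ^ (k + 1)) := by
            apply le_mul_of_one_le_right (by positivity)
            have : 0 < 2 * CP * CD ^ (k + 1) := by positivity
            linarith)
    (by
      calc _ ≤ Mass pi (gball G x R) (fun w => gO K pi φ w - c) := h.Mass_mono (h.sub hz) _
        _ ≤ (2 * CP * R ^ θ) ^ 2 * Mass pi univ φ := hP
        _ ≤ (2 * CP * R ^ θ) ^ 2 * (N ^ 2 * (CD ^ (k + 1) * vol G pi z s)) := by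
            gcongr
            exact hφ.trans (by gcongr)
        _ ≤ (2 * CP * R ^ θ) ^ 2 * (N ^ 2 * ((CD ^ (k + 1)) ^ 2 * vol G pi z s)) := by
            gcongr
            nlinarith
        _ = (N * R ^ θ * (2 * CP * CD ^ (k + 1))) ^ 2 * vol G pi z s := by ring
        _ ≤ _ := by
            gcongr
            linarith)
  unfold cS
  calc _ ≤ _ := this
    _ = _ := by ring

/-- delta -/
noncomputable def dl (pi : V → ℝ) (y z : V) : ℝ := if z = y then 1 / pi y else 0

/-- uniform on ball -/
noncomputable def un (G : SimpleGraph V) (pi : V → ℝ) (y : V) (r : ℝ) (z : V) : ℝ :=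
  if z ∈ gball G y r then 1 / vol G pi y r else 0

lemma HS.inn_dl (h : HS G K pi θ CD CP C2) (y : V) (u : V → ℝ) : inn pi (dl pi y) u = u y := by
  unfold inn dl
  rw [Finset.sum_eq_single y]
  · have := (h.ppos y).ne'
    simp; field_simp
  · intro z _ hz; simp [hz]
  · simp

lemma inn_un (y : V) (r : ℝ) (u : V → ℝ) : inn pi (un G pi y r) u = ballAvg G pi y r u := by
  unfold inn un ballAvg
  rw [Finset.mul_sum, ← Finset.sum_subset (Finset.subset_univ (gball G y r))]
  · apply Finset.sum_congr rfl; intro z hz; rw [if_pos hz]; ring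
  · intro z _ hz; rw [if_neg hz]; ring

lemma HS.avg_const (h : HS G K pi θ CD CP C2) (y : V) {r : ℝ} (hr : 0 ≤ r) (c : ℝ) :
    ballAvg G pi y r (fun _ => c) = c := by
  have := (h.vol_pos y hr).ne'
  unfold ballAvg
  rw [← Finset.mul_sum]
  change (vol G pi y r)⁻¹ * (c * vol G pi y r) = c
  field_simp

lemma HS.avg_near (h : HS G K pi θ CD CP C2) (y : V) {r : ℝ} (hr : 0 ≤ r) (u : V → ℝ) (c ε : ℝ)
    (hu : ∀ z ∈ gball G y r, |u z - c| ≤ ε) : |ballAvg G pi y r u - c| ≤ ε := by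
  have hv := h.vol_pos y hr
  have e1 : ballAvg G pi y r u - c = (vol G pi y r)⁻¹ * ∑ z ∈ gball G y r, (u z - c) * pi z := by
    conv_lhs => rw [← h.avg_const y hr c]
    unfold ballAvg
    rw [← mul_sub, ← Finset.sum_sub_distrib]
    congr 1
    apply Finset.sum_congr rfl; intro z _; ring
  rw [e1, abs_mul, abs_of_pos (inv_pos.mpr hv), inv_mul_le_iff₀ hv]
  calc _ ≤ ∑ z ∈ gball G y r, |(u z - c) * pi z| := Finset.abs_sum_le_sum_abs _ _
    _ ≤ ∑ z ∈ gball G y r, pi z * ε := by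
        apply Finset.sum_le_sum; intro z hz
        rw [abs_mul, abs_of_pos (h.ppos z), mul_comm]
        exact mul_le_mul_of_nonneg_left (hu z hz) (h.ppos z).le
    _ = _ := by rw [← Finset.sum_mul]; rfl

lemma HS.osc (h : HS G K pi θ CD CP C2) (y : V) {r : ℝ} (hr : 0 ≤ r) (u : V → ℝ) (c ε : ℝ)
    (hu : ∀ z ∈ gball G y r, |u z - c| ≤ ε) :
    |inn pi (fun z => dl pi y z - un G pi y r z) u| ≤ 2 * ε := by
  rw [inn_sub_left, h.inn_dl, inn_un]
  have h1 := hu y (self_mem hr)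
  have h2 := h.avg_near y hr u c ε hu
  rw [abs_le] at *
  constructor <;> linarith

lemma sum_eq_inn (φ : V → ℝ) : ∑ z, φ z * pi z = inn pi φ (fun _ => 1) := by
  unfold inn; simp

lemma HS.mean_dl_un (h : HS G K pi θ CD CP C2) (y : V) {r : ℝ} (hr : 0 ≤ r) :
    ∑ z, (dl pi y z - un G pi y r z) * pi z = 0 := by
  rw [sum_eq_inn (fun z => dl pi y z - un G pi y r z), inn_sub_left, h.inn_dl, inn_un,
    h.avg_const y hr, sub_self]

lemma HS.mean_un_un (h : HS G K pi θ CD CP C2) (y : V) {r r' : ℝ} (hr : 0 ≤ r) (hr' : 0 ≤ r') :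
    ∑ z, (un G pi y r z - un G pi y r' z) * pi z = 0 := by
  rw [sum_eq_inn (fun z => un G pi y r z - un G pi y r' z), inn_sub_left, inn_un, inn_un,
    h.avg_const y hr, h.avg_const y hr', sub_self]

/-- bracket bound -/
lemma HS.bracket (h : HS G K pi θ CD CP C2) (x y : V) {r r' : ℝ} (hr : 0 < r)
    (hd : (G.dist y x : ℝ) ≤ 8 * r) (hr0 : 0 ≤ r') (hr' : r' ≤ 2 * r) :
    |inn pi (fun z => dl pi x z - un G pi x r' z)
      (gO K pi (fun z => un G pi y r z - un G pi y (2 * r) z))| ≤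
      2 * (cS θ CD CP C2 4 * (1 / vol G pi y r * (16 * r) ^ θ)) := by
  have hv := h.vol_pos y hr.le
  have hv2 := h.vol_pos y (r := 2 * r) (by linarith)
  have hvm := h.vol_mono (x := y) (show r ≤ 2 * r by linarith)
  have hsup : ∀ w, |un G pi y r w - un G pi y (2 * r) w| ≤ 1 / vol G pi y r := by
    intro w
    have a1 : 0 ≤ un G pi y r w := by unfold un; split_ifs <;> positivity
    have a2 : 0 ≤ un G pi y (2 * r) w := by unfold un; split_ifs <;> positivity
    have a3 : un G pi y r w ≤ 1 / vol G pi y r := by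
      unfold un; split_ifs
      · exact le_rfl
      · positivity
    have a4 : un G pi y (2 * r) w ≤ 1 / vol G pi y r := by
      unfold un; split_ifs
      · exact one_div_le_one_div_of_le hv hvm
      · positivity
    rw [abs_le]; constructor <;> linarith
  have hsupp : ∀ w, w ∉ gball G y (2 * r) → un G pi y r w - un G pi y (2 * r) w = 0 := by
    intro w hw
    have : w ∉ gball G y r := fun hc => hw (gball_mono (by linarith) hc)
    unfold un; rw [if_neg hw, if_neg this, sub_zero]
  apply h.osc x hr0 _ (ballAvg G pi y (16 * r)
    (gO K pi (fun z => un G pi y r z - un G pi y (2 * r) z)))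
  intro z hz
  rw [mem_gball] at hz
  have htri := h.tri y x z
  apply h.lemS y z (s := r) 4 hr (by positivity) _ (h.mean_un_un y hr.le (by linarith))
  · intro w hw
    exact hsupp w fun hc => hw (gball_mono (by linarith) hc)
  · calc Mass pi univ (fun z => un G pi y r z - un G pi y (2 * r) z)
        = Mass pi (gball G y (16 * r)) (fun z => un G pi y r z - un G pi y (2 * r) z) := by
          unfold Mass
          symm
          apply Finset.sum_subset (Finset.subset_univ _)
          intro w _ hw
          beta_reduce; rw [hsupp w fun hc => hw (gball_mono (by linarith) hc)]; ring
      _ ≤ ∑ w ∈ gball G y (16 * r), (1 / vol G pi y r) ^ 2 * pi w := by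
          apply Finset.sum_le_sum; intro w _
          apply mul_le_mul_of_nonneg_right _ (h.ppos w).le
          exact sq_le_sq.mpr (by rw [abs_of_pos (show 0 < 1 / vol G pi y r by positivity)]; exact hsup w)
      _ = _ := by rw [← Finset.mul_sum]; rfl
  · linarith
  · norm_num
  · exact fun w _ => hsup w

/-- the main local term -/
lemma HS.lemI (h : HS G K pi θ CD CP C2) (x y : V) {d : ℝ} (hd : d = G.dist x y) (hd0 : 0 < d) :
    |inn pi (fun z => dl pi x z - un G pi x (d / 8) z)
      (gO K pi (fun z => dl pi y z - un G pi y (d / 8) z))| ≤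
      cMV θ CD CP C2 * (2 * cS θ CD CP C2 3) * ((2 * d) ^ θ / vol G pi x (d / 8)) := by
  set ρ := d / 8 with hρ
  have hρ0 : 0 < ρ := by positivity
  have hCS := h.cS_pos 3
  have hv := h.vol_pos x hρ0.le
  set φy : V → ℝ := fun z => dl pi y z - un G pi y ρ z with hφy
  set W := gO K pi φy with hW
  set c := ballAvg G pi x ρ W with hc
  set B := gball G x ρ with hB
  set ψ : V → ℝ := fun z => if z ∈ B then W z - c else 0 with hψ
  have hψs : ∀ z, z ∉ B → ψ z = 0 := fun z hz => by simp [hψ, hz]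
  have hψ0 : ∑ z, ψ z * pi z = 0 := by
    have e1 : ∑ z, ψ z * pi z = ∑ z ∈ B, W z * pi z - c * vol G pi x ρ := by
      simp only [hψ, ite_mul, zero_mul, Finset.sum_ite_mem, Finset.univ_inter, sub_mul,
        Finset.sum_sub_distrib, ← Finset.mul_sum]
      rfl
    rw [e1, hc, ballAvg]; field_simp; rw [← hB]; ring
  have hMψ : Mass pi univ ψ = Mass pi B (fun z => W z - c) := by
    unfold Mass
    rw [← Finset.sum_subset (Finset.subset_univ B) (fun z _ hz => by rw [hψs z hz]; ring)]
    apply Finset.sum_congr rfl; intro z hz; simp [hψ, hz]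
  have hinn : inn pi ψ W = Mass pi univ ψ := by
    rw [← inn_shift ψ W c hψ0]
    unfold inn Mass
    apply Finset.sum_congr rfl; intro z _
    by_cases hz : z ∈ B
    · simp only [hψ, hz, if_true]; ring
    · simp [hψs z hz]
  set X := Mass pi univ ψ with hX
  have X0 : 0 ≤ X := h.Mass_nonneg _ _
  have hvx := h.vol_pos x (r := 2 * d) (by linarith)
  set N := √(X / vol G pi x (2 * d)) with hN
  have hNsq : N ^ 2 * vol G pi x (2 * d) = X := by
    rw [hN, Real.sq_sqrt (by positivity)]; field_simp
  have h1 : X ≤ 2 * (cS θ CD CP C2 3 * (N * (2 * d) ^ θ)) := by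
    rw [← hinn, hW, h.gO_symm]
    refine (le_abs_self _).trans ?_
    apply h.osc y hρ0.le _ (ballAvg G pi x (2 * d) (gO K pi ψ))
    intro z hz
    rw [mem_gball] at hz
    have t1 := h.tri x y z
    apply h.lemS x z (s := d / 4) 3 (by positivity) (by positivity) ψ hψ0
    · intro w hw; apply hψs; intro hc; exact hw (gball_mono (by linarith) hc)
    · rw [hNsq]
    · rw [← hd] at t1; linarith
    · apply le_of_eq; ring
    · intro w hw
      rw [mem_gball] at hw
      rw [hψs w, abs_zero]
      · positivity
      · rw [hB, mem_gball]
        intro hxw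
        have t2 := h.tri x w y
        have t3 := h.tri w z y
        rw [h.comm w z, h.comm z y] at t3
        rw [← hd] at t2
        linarith
  have h2 : X ≤ ((2 * cS θ CD CP C2 3) * ((2 * d) ^ θ / vol G pi x ρ)) ^ 2 * vol G pi x ρ := by
    have hA : X ^ 2 ≤ (2 * (cS θ CD CP C2 3 * (N * (2 * d) ^ θ))) ^ 2 :=
      pow_le_pow_left₀ X0 h1 2
    have hvm : vol G pi x ρ ≤ vol G pi x (2 * d) := h.vol_mono (by linarith)
    rcases X0.eq_or_lt with h3 | h3
    · rw [← h3]; positivity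
    · have h4 : X * vol G pi x (2 * d) ≤ (2 * cS θ CD CP C2 3 * (2 * d) ^ θ) ^ 2 := by
        have : X * (X * vol G pi x (2 * d)) ≤ X * (2 * cS θ CD CP C2 3 * (2 * d) ^ θ) ^ 2 := by
          calc X * (X * vol G pi x (2 * d)) = X ^ 2 * vol G pi x (2 * d) := by ring
            _ ≤ (2 * (cS θ CD CP C2 3 * (N * (2 * d) ^ θ))) ^ 2 * vol G pi x (2 * d) := by gcongr
            _ = (N ^ 2 * vol G pi x (2 * d)) * (2 * cS θ CD CP C2 3 * (2 * d) ^ θ) ^ 2 := by ring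
            _ = _ := by rw [hNsq]
        exact le_of_mul_le_mul_left this h3
      have h5 : X * vol G pi x ρ ≤ (2 * cS θ CD CP C2 3 * (2 * d) ^ θ) ^ 2 :=
        le_trans (by gcongr) h4
      have e : ((2 * cS θ CD CP C2 3) * ((2 * d) ^ θ / vol G pi x ρ)) ^ 2 * vol G pi x ρ =
          (2 * cS θ CD CP C2 3 * (2 * d) ^ θ) ^ 2 / vol G pi x ρ := by field_simp
      rw [e, le_div_iff₀ hv]; exact h5
  have hlap : ∀ z ∈ B, |lap K W z| ≤ 0 := by
    intro z hz
    rw [hB, mem_gball] at hz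
    rw [hW, h.gO_lap, h.mean_dl_un y hρ0.le, sub_zero]
    have t2 := h.tri x z y
    rw [← hd] at t2
    have hzy : z ∉ gball G y ρ := by
      rw [mem_gball, h.comm]; intro hc; linarith
    have hne : z ≠ y := by
      rintro rfl; exact hzy (self_mem hρ0.le)
    simp [hφy, dl, un, hzy, hne]
  have := h.mv2 x hρ0 W c le_rfl hlap
    (N := (2 * cS θ CD CP C2 3) * ((2 * d) ^ θ / vol G pi x ρ)) (by positivity)
    (by rw [zero_mul]; positivity) (by rw [← hMψ]; exact h2)
  rw [inn_sub_left, h.inn_dl, inn_un, ← hc]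
  calc _ ≤ _ := this
    _ = _ := by ring


lemma gB_sub (a b c : V → ℝ) : inn pi a (gO K pi (fun z => b z - c z)) =
    inn pi a (gO K pi b) - inn pi a (gO K pi c) := by
  rw [← inn_sub_right]
  congr 1
  funext z; exact gO_sub b c z

lemma HS.gO_dl (h : HS G K pi θ CD CP C2) (x y : V) : gO K pi (dl pi y) x = green K pi x y := by
  unfold gO dl
  rw [Finset.sum_eq_single y]
  · have := (h.ppos y).ne'
    simp [this]
  · intro z _ hz; simp [hz]
  · simp

/-- the telescoping quantity -/
noncomputable def ck (G : SimpleGraph V) (K : V → V → ℝ) (pi : V → ℝ) (x y : V) (r : ℝ) : ℝ :=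
  inn pi (dl pi x) (gO K pi (un G pi y r)) + inn pi (un G pi x r) (gO K pi (dl pi y))
    - inn pi (un G pi x r) (gO K pi (un G pi y r))

lemma HS.green_split (h : HS G K pi θ CD CP C2) (x y : V) (r : ℝ) :
    green K pi x y = inn pi (fun z => dl pi x z - un G pi x r z)
      (gO K pi (fun z => dl pi y z - un G pi y r z)) + ck G K pi x y r := by
  rw [gB_sub, inn_sub_left, inn_sub_left, ck, h.inn_dl x (gO K pi (dl pi y)), h.gO_dl]
  ring

/-- constant -/
noncomputable def cB (θ CD CP C2 : ℝ) : ℝ := 2 * cS θ CD CP C2 4 * 16 ^ θ * (1 + CD ^ 4)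

/-- constant -/
noncomputable def cI (θ CD CP C2 : ℝ) : ℝ := cMV θ CD CP C2 * (2 * cS θ CD CP C2 3) * 16 ^ θ

lemma HS.cB_pos (h : HS G K pi θ CD CP C2) : 0 < cB θ CD CP C2 := by
  have := h.cS_pos 4
  have := h.CD1
  unfold cB; positivity

lemma HS.cI_pos (h : HS G K pi θ CD CP C2) : 0 < cI θ CD CP C2 := by
  have := h.cS_pos 3
  have := h.cMV_pos
  unfold cI; positivity

lemma HS.ck_step (h : HS G K pi θ CD CP C2) (x y : V) {r : ℝ} (hr : 0 < r)
    (hd : (G.dist x y : ℝ) ≤ 8 * r) :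
    |ck G K pi x y r - ck G K pi x y (2 * r)| ≤ cB θ CD CP C2 * (r ^ θ / vol G pi x r) := by
  have e : ck G K pi x y r - ck G K pi x y (2 * r) =
      inn pi (fun z => dl pi x z - un G pi x (2 * r) z)
        (gO K pi (fun z => un G pi y r z - un G pi y (2 * r) z)) +
      inn pi (fun z => dl pi y z - un G pi y r z)
        (gO K pi (fun z => un G pi x r z - un G pi x (2 * r) z)) := by
    rw [h.gO_symm (fun z => dl pi y z - un G pi y r z)]
    rw [gB_sub, gB_sub, inn_sub_left, inn_sub_left, inn_sub_left, inn_sub_left]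
    unfold ck; ring
  have b1 := h.bracket x y hr (r' := 2 * r) (by rw [h.comm]; exact hd) (by linarith) le_rfl
  have b2 := h.bracket y x hr (r' := r) hd hr.le (by linarith)
  have hvx := h.vol_pos x hr.le
  have hvy := h.vol_pos y hr.le
  have hc : vol G pi x r ≤ CD ^ 4 * vol G pi y r := by
    apply h.vol_cmp 4 hr
    rw [h.comm]; linarith
  have hS := h.cS_pos 4
  have h16 : (16 * r) ^ θ = 16 ^ θ * r ^ θ := Real.mul_rpow (by norm_num) hr.le
  have hinv : 1 / vol G pi y r ≤ CD ^ 4 * (1 / vol G pi x r) := by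
    rw [mul_one_div, div_le_div_iff₀ hvy hvx]; linarith
  rw [e]
  refine (abs_add_le _ _).trans ((add_le_add b1 b2).trans ?_)
  rw [h16]
  calc _ ≤ 2 * (cS θ CD CP C2 4 * ((CD ^ 4 * (1 / vol G pi x r)) * (16 ^ θ * r ^ θ))) +
        2 * (cS θ CD CP C2 4 * (1 / vol G pi x r * (16 ^ θ * r ^ θ))) := by gcongr
    _ = _ := by unfold cB; ring

lemma HS.un_univ (h : HS G K pi θ CD CP C2) (x : V) {r : ℝ} (hr : ∀ z, (G.dist x z : ℝ) ≤ r) :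
    un G pi x r = fun _ => 1 := by
  have hb : gball G x r = univ := by
    ext z; simp [mem_gball, hr]
  funext z
  unfold un vol
  rw [hb, h.psum]; simp

lemma HS.ck_zero (h : HS G K pi θ CD CP C2) (x y : V) {r : ℝ} (hr : ∀ w z, (G.dist w z : ℝ) ≤ r) :
    ck G K pi x y r = 0 := by
  have hz : gO K pi (fun _ => (1:ℝ)) = fun _ => 0 := by funext z; exact h.gO_const 1 z
  unfold ck
  rw [h.un_univ x (hr x), h.un_univ y (hr y), h.gO_symm (fun _ => 1) (dl pi y), hz]
  simp [inn]

lemma HS.ck_sum (h : HS G K pi θ CD CP C2) (x y : V) {ρ : ℝ} (hρ : 0 < ρ)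
    (hd : (G.dist x y : ℝ) ≤ 8 * ρ) (n : ℕ) :
    |ck G K pi x y ρ| ≤ cB θ CD CP C2 * ∑ k ∈ range n, (2 ^ k * ρ) ^ θ / vol G pi x (2 ^ k * ρ) +
      |ck G K pi x y (2 ^ n * ρ)| := by
  induction n with
  | zero => simp
  | succ n ih =>
    have h1 : (1:ℝ) ≤ 2 ^ n := one_le_pow₀ (by norm_num)
    have hs := h.ck_step x y (r := 2 ^ n * ρ) (by positivity) (by nlinarith)
    have e : (2:ℝ) * (2 ^ n * ρ) = 2 ^ (n + 1) * ρ := by ring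
    rw [e] at hs
    rw [Finset.sum_range_succ, mul_add]
    have := abs_sub_abs_le_abs_sub (ck G K pi x y (2 ^ n * ρ)) (ck G K pi x y (2 ^ (n + 1) * ρ))
    linarith

lemma HS.first (h : HS G K pi θ CD CP C2) (x y : V) {d : ℝ} (hd : d = max (G.dist x y : ℝ) 1) :
    |inn pi (fun z => dl pi x z - un G pi x (d / 8) z)
      (gO K pi (fun z => dl pi y z - un G pi y (d / 8) z))| ≤
      cI θ CD CP C2 * ((d / 8) ^ θ / vol G pi x (d / 8)) := by
  have hd1 : 1 ≤ d := by rw [hd]; exact le_max_right _ _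
  have hcI := h.cI_pos
  have hv := h.vol_pos x (r := d / 8) (by linarith)
  rcases Nat.eq_zero_or_pos (G.dist x y) with h0 | h0
  · have hd' : d = 1 := by rw [hd, h0]; simp
    have e : ∀ z, dl pi x z = un G pi x (d / 8) z := by
      intro z
      have hb : gball G x (d / 8) = {x} := by
        ext w
        rw [mem_gball, Finset.mem_singleton]
        constructor
        · intro hw
          have h2 : (G.dist x w : ℝ) < 1 := by linarith
          have h3 : G.dist x w = 0 := by
            have : G.dist x w < 1 := by exact_mod_cast h2
            omega
          exact ((h.conn.dist_eq_zero_iff).mp h3).symm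
        · rintro rfl; simp; linarith
      unfold un dl vol
      rw [hb]; simp
    have : (fun z => dl pi x z - un G pi x (d / 8) z) = fun _ => 0 := by
      funext z; rw [e z, sub_self]
    rw [this]
    have : inn pi (fun _ => (0:ℝ)) (gO K pi fun z => dl pi y z - un G pi y (d / 8) z) = 0 := by
      simp [inn]
    rw [this, abs_zero]; positivity
  · have hd' : d = G.dist x y := by
      rw [hd]; apply max_eq_left; exact_mod_cast h0
    refine (h.lemI x y hd' (by linarith)).trans (le_of_eq ?_)
    have : (2 * d) ^ θ = 16 ^ θ * (d / 8) ^ θ := by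
      rw [← Real.mul_rpow (by norm_num) (by positivity)]; congr 1; ring
    rw [this]; unfold cI; ring

lemma HS.block (h : HS G K pi θ CD CP C2) (x : V) {T : ℝ} (hT : 1 ≤ T) :
    T ^ θ / vol G pi x (2 * T) ≤
      2 * ∑ i ∈ Finset.Icc ⌈T ^ θ⌉₊ ⌊2 * T ^ θ⌋₊, 1 / vol G pi x ((i : ℝ) ^ (1 / θ)) := by
  have hθ := h.hθ
  set t := T ^ θ with ht
  have ht1 : 1 ≤ t := Real.one_le_rpow hT (by linarith)
  have hv := h.vol_pos x (r := 2 * T) (by linarith)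
  have hterm : ∀ i ∈ Finset.Icc ⌈t⌉₊ ⌊2 * t⌋₊,
      1 / vol G pi x (2 * T) ≤ 1 / vol G pi x ((i : ℝ) ^ (1 / θ)) := by
    intro i hi
    rw [Finset.mem_Icc] at hi
    have hi2 : (i : ℝ) ≤ 2 * t := (Nat.le_floor_iff (by linarith)).mp hi.2
    apply one_div_le_one_div_of_le (h.vol_pos x (by positivity))
    apply h.vol_mono
    calc (i : ℝ) ^ (1 / θ) ≤ ((2 * T) ^ θ) ^ (1 / θ) := by
          apply Real.rpow_le_rpow (by positivity) _ (by positivity)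
          refine hi2.trans ?_
          rw [Real.mul_rpow (by norm_num) (by linarith)]
          have : (2:ℝ) ≤ 2 ^ θ := Real.self_le_rpow_of_one_le (by norm_num) (by linarith)
          nlinarith
      _ = 2 * T := by
          rw [← Real.rpow_mul (by linarith), mul_one_div_cancel (by linarith), Real.rpow_one]
  have hs := Finset.card_nsmul_le_sum _ _ _ hterm
  have hcard : t / 2 ≤ ((Finset.Icc ⌈t⌉₊ ⌊2 * t⌋₊).card : ℝ) := by
    have a1 : (⌈t⌉₊ : ℝ) < t + 1 := Nat.ceil_lt_add_one (by linarith)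
    have a2 : 2 * t < (⌊2 * t⌋₊ : ℝ) + 1 := Nat.lt_floor_add_one _
    have a3 : ⌈t⌉₊ ≤ ⌊2 * t⌋₊ := Nat.le_floor (by linarith)
    rw [Nat.card_Icc, Nat.cast_sub (by omega)]
    have a3' : (⌈t⌉₊ : ℝ) ≤ (⌊2 * t⌋₊ : ℝ) := by exact_mod_cast a3
    push_cast
    rcases le_total t 2 with h2 | h2 <;> linarith
  rw [nsmul_eq_mul] at hs
  calc t / vol G pi x (2 * T) = 2 * (t / 2 * (1 / vol G pi x (2 * T))) := by ring
    _ ≤ 2 * ((Finset.Icc ⌈t⌉₊ ⌊2 * t⌋₊).card * (1 / vol G pi x (2 * T))) := by gcongr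
    _ ≤ _ := by gcongr

lemma dist_le_gdiam (x y : V) : G.dist x y ≤ gdiam G := by
  unfold gdiam
  exact (Finset.le_sup (f := fun y => G.dist x y) (Finset.mem_univ y)).trans
    (Finset.le_sup (f := fun x => univ.sup fun y => G.dist x y) (Finset.mem_univ x))

/-- constant -/
noncomputable def cF (θ CD CP C2 : ℝ) : ℝ :=
  (cI θ CD CP C2 + cB θ CD CP C2 * (1 + 3 * 8 ^ θ)) * (CD ^ 4 * 2)

set_option maxHeartbeats 1600000 in
lemma HS.final (h : HS G K pi θ CD CP C2) (x y : V) :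
    |green K pi x y| ≤ cF θ CD CP C2 *
      ∑ n ∈ Finset.Icc ⌈((G.dist x y : ℝ)) ^ θ⌉₊ ⌊2 * (gdiam G : ℝ) ^ θ⌋₊,
        1 / vol G pi x ((n : ℝ) ^ (1 / θ)) := by
  have hθ := h.hθ
  have hcI := h.cI_pos
  have hcB := h.cB_pos
  have hCD := h.CD1
  have hF : 0 ≤ cF θ CD CP C2 := by unfold cF; positivity
  have hdd := dist_le_gdiam (G := G) x y
  have hnn : ∀ n : ℕ, 0 ≤ 1 / vol G pi x ((n : ℝ) ^ (1 / θ)) := fun n =>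
    (one_div_pos.mpr (h.vol_pos x (by positivity))).le
  rcases Nat.eq_zero_or_pos (gdiam G) with hD0 | hD0
  · have hall : ∀ z : V, z = y := by
      intro z
      have := dist_le_gdiam (G := G) z y
      exact (h.conn.dist_eq_zero_iff).mp (by omega)
    have hm := h.green_mean y
    have hu : (univ : Finset V) = {y} := by ext z; simp [hall z]
    rw [hu, Finset.sum_singleton] at hm
    have hg : green K pi x y = 0 := by
      rw [hall x]
      exact (mul_eq_zero.mp hm).resolve_right (h.ppos y).ne'
    rw [hg, abs_zero]
    exact mul_nonneg hF (Finset.sum_nonneg fun n _ => hnn n)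
  set D : ℝ := (gdiam G : ℝ) with hD
  have hD1 : 1 ≤ D := by rw [hD]; exact_mod_cast hD0
  obtain ⟨d, hd⟩ : ∃ d : ℝ, d = max (G.dist x y : ℝ) 1 := ⟨_, rfl⟩
  have hd1 : 1 ≤ d := by rw [hd]; exact le_max_right _ _
  have hdx : (G.dist x y : ℝ) ≤ d := by rw [hd]; exact le_max_left _ _
  have hdD : d ≤ D := by rw [hd]; exact max_le (by rw [hD]; exact_mod_cast hdd) hD1
  obtain ⟨m, hm1, hm2⟩ := exists_nat_pow_near (x := D / d) (y := 2)
    ((one_le_div (by linarith)).mpr hdD) (by norm_num)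
  rw [le_div_iff₀ (by linarith)] at hm1
  rw [div_lt_iff₀ (by linarith)] at hm2
  obtain ⟨ρ, hρ⟩ : ∃ ρ : ℝ, ρ = d / 8 := ⟨_, rfl⟩
  have hρ0 : 0 < ρ := by rw [hρ]; positivity
  set a : ℕ → ℝ := fun k => (2 ^ k * ρ) ^ θ / vol G pi x (2 ^ k * ρ) with ha
  have hv : ∀ k : ℕ, 0 < vol G pi x (2 ^ k * ρ) := fun k => h.vol_pos x (by positivity)
  have ha0 : ∀ k, 0 ≤ a k := fun k => div_nonneg (by positivity) (hv k).le
  have hsum := h.ck_sum x y hρ0 (by rw [hρ]; linarith) (m + 4)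
  rw [h.ck_zero x y (r := 2 ^ (m + 4) * ρ) (by
    intro w z
    have h1 : (G.dist w z : ℝ) ≤ D := by rw [hD]; exact_mod_cast dist_le_gdiam w z
    have : (2:ℝ) ^ (m + 4) * ρ = 2 ^ (m + 1) * d := by rw [hρ, pow_add, pow_add]; ring
    rw [this]; linarith)] at hsum
  rw [abs_zero, add_zero] at hsum
  have hfirst := h.first x y hd
  rw [← hρ] at hfirst
  have hg : |green K pi x y| ≤ cI θ CD CP C2 * a 0 + cB θ CD CP C2 * ∑ k ∈ range (m + 4), a k := by
    rw [h.green_split x y ρ]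
    refine (abs_add_le _ _).trans (add_le_add ?_ hsum)
    simpa [ha] using hfirst
  set S := ∑ k ∈ range (m + 1), a k with hS
  have hS0 : a 0 ≤ S := Finset.single_le_sum (fun k _ => ha0 k) (by simp)
  have hSm : a m ≤ S := Finset.single_le_sum (fun k _ => ha0 k) (by simp)
  have hj : ∀ j ≤ 3, a (m + j) ≤ 8 ^ θ * S := by
    intro j hj
    have hp1 : (1:ℝ) ≤ 2 ^ j := one_le_pow₀ (by norm_num)
    have hp : (2:ℝ) ^ j ≤ 8 := by
      calc (2:ℝ) ^ j ≤ 2 ^ 3 := pow_le_pow_right₀ (by norm_num) hj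
        _ = 8 := by norm_num
    have hR : 0 < 2 ^ m * ρ := by positivity
    have e : (2:ℝ) ^ (m + j) * ρ = 2 ^ j * (2 ^ m * ρ) := by rw [pow_add]; ring
    have : a (m + j) ≤ 8 ^ θ * a m := by
      simp only [ha]
      rw [e, ← mul_div_assoc (8 ^ θ), ← Real.mul_rpow (by norm_num) hR.le]
      apply div_le_div₀ (by positivity)
      · apply Real.rpow_le_rpow (by positivity) _ (by linarith)
        gcongr
      · exact hv m
      · apply h.vol_mono; nlinarith
    refine this.trans ?_
    gcongr
  have hS4 : ∑ k ∈ range (m + 4), a k ≤ (1 + 3 * 8 ^ θ) * S := by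
    have e : ∑ k ∈ range (m + 4), a k = S + a (m + 1) + a (m + 2) + a (m + 3) := by
      rw [hS, Finset.sum_range_succ a (m + 3), Finset.sum_range_succ a (m + 2),
        Finset.sum_range_succ a (m + 1)]
    rw [e]
    linarith [hj 1 (by norm_num), hj 2 (by norm_num), hj 3 (by norm_num)]
  have hg2 : |green K pi x y| ≤ (cI θ CD CP C2 + cB θ CD CP C2 * (1 + 3 * 8 ^ θ)) * S := by
    calc _ ≤ _ := hg
      _ ≤ cI θ CD CP C2 * S + cB θ CD CP C2 * ((1 + 3 * 8 ^ θ) * S) := by gcongr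
      _ = _ := by ring
  set T : ℕ → ℝ := fun k => 2 ^ k * d with hT
  have hT1 : ∀ k, 1 ≤ T k := fun k => by
    have : (1:ℝ) ≤ 2 ^ k := one_le_pow₀ (by norm_num)
    simp only [hT]; nlinarith
  set J : ℕ → Finset ℕ := fun k => Finset.Icc ⌈T k ^ θ⌉₊ ⌊2 * T k ^ θ⌋₊ with hJ
  set F : ℕ → ℝ := fun n => 1 / vol G pi x ((n : ℝ) ^ (1 / θ)) with hFd
  have hak : ∀ k, a k ≤ CD ^ 4 * 2 * ∑ i ∈ J k, F i := by
    intro k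
    have hb := h.block x (hT1 k)
    have hTk := hT1 k
    have e : T k = 8 * (2 ^ k * ρ) := by simp only [hT, hρ]; ring
    have hc : vol G pi x (2 * T k) ≤ CD ^ 4 * vol G pi x (2 ^ k * ρ) := by
      have := h.vdn 4 x (r := 2 ^ k * ρ) (by positivity)
      have e2 : 2 * T k = 2 ^ 4 * (2 ^ k * ρ) := by rw [e]; ring
      rw [e2]; exact this
    have hv2 := h.vol_pos x (r := 2 * T k) (by linarith)
    have hR : 0 < 2 ^ k * ρ := by positivity
    calc a k ≤ T k ^ θ / vol G pi x (2 ^ k * ρ) := by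
          simp only [ha]
          have := (hv k).le
          gcongr
          linarith
      _ ≤ CD ^ 4 * (T k ^ θ / vol G pi x (2 * T k)) := by
          rw [← mul_div_assoc (CD ^ 4), div_le_div_iff₀ (hv k) hv2]
          have : 0 ≤ T k ^ θ := by positivity
          nlinarith
      _ ≤ CD ^ 4 * (2 * ∑ i ∈ J k, F i) := by gcongr
      _ = _ := by ring
  have hdisj : ∀ k l, k < l → Disjoint (J k) (J l) := by
    intro k l hkl
    rw [Finset.disjoint_left]
    intro i hi hi'
    simp only [hJ, Finset.mem_Icc] at hi hi'
    have hTk := hT1 k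
    have h1 : (i:ℝ) ≤ 2 * T k ^ θ := (Nat.le_floor_iff (by positivity)).mp hi.2
    have h2 : T l ^ θ ≤ i := Nat.ceil_le.mp hi'.1
    have h3 : 2 * T k ≤ T l := by
      simp only [hT]
      have : (2:ℝ) ^ (k + 1) ≤ 2 ^ l := pow_le_pow_right₀ (by norm_num) hkl
      rw [pow_succ] at this; nlinarith
    have h4 : (2 * T k) ^ θ ≤ T l ^ θ := Real.rpow_le_rpow (by linarith) h3 (by linarith)
    rw [Real.mul_rpow (by norm_num) (by linarith)] at h4
    have h5 : (2:ℝ) ^ (2:ℝ) ≤ 2 ^ θ := Real.rpow_le_rpow_of_exponent_le (by norm_num) hθ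
    have h6 : (2:ℝ) ^ (2:ℝ) = 4 := by norm_num
    have h7 : 0 < T k ^ θ := by positivity
    nlinarith
  have hSJ : S ≤ CD ^ 4 * 2 * ∑ i ∈ Finset.Icc ⌈((G.dist x y : ℝ)) ^ θ⌉₊ ⌊2 * D ^ θ⌋₊, F i := by
    calc S ≤ ∑ k ∈ range (m + 1), CD ^ 4 * 2 * ∑ i ∈ J k, F i :=
          Finset.sum_le_sum fun k _ => hak k
      _ = CD ^ 4 * 2 * ∑ i ∈ (range (m + 1)).biUnion J, F i := by
          rw [← Finset.mul_sum, Finset.sum_biUnion]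
          intro k _ l _ hkl
          rcases lt_or_gt_of_ne hkl with h1 | h1
          · exact hdisj k l h1
          · exact (hdisj l k h1).symm
      _ ≤ _ := by
          refine mul_le_mul_of_nonneg_left (Finset.sum_le_sum_of_subset_of_nonneg ?_
            fun i _ _ => hnn i) (by positivity)
          intro i hi
          rw [Finset.mem_biUnion] at hi
          obtain ⟨k, hk, hik⟩ := hi
          rw [Finset.mem_range] at hk
          simp only [hJ, Finset.mem_Icc] at hik
          rw [Finset.mem_Icc]
          have hTk := hT1 k
          have hpk : (1:ℝ) ≤ 2 ^ k := one_le_pow₀ (by norm_num)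
          have hTD : T k ≤ D := by
            have : (2:ℝ) ^ k ≤ 2 ^ m := pow_le_pow_right₀ (by norm_num) (by omega)
            simp only [hT]; nlinarith
          have hdT : (G.dist x y : ℝ) ≤ T k := by
            simp only [hT]; nlinarith
          constructor
          · refine le_trans (Nat.ceil_le_ceil ?_) hik.1
            exact Real.rpow_le_rpow (by positivity) hdT (by linarith)
          · refine hik.2.trans (Nat.floor_le_floor ?_)
            have := Real.rpow_le_rpow (by linarith) hTD (show 0 ≤ θ by linarith)
            linarith
  calc _ ≤ _ := hg2
    _ ≤ (cI θ CD CP C2 + cB θ CD CP C2 * (1 + 3 * 8 ^ θ)) *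
        (CD ^ 4 * 2 * ∑ i ∈ Finset.Icc ⌈((G.dist x y : ℝ)) ^ θ⌉₊ ⌊2 * D ^ θ⌋₊, F i) := by gcongr
    _ = _ := by unfold cF; ring

end Helpers

/-- For a lazy Harnack graph, the normalized Green function satisfies
`|𝒢(x,y)| ≤ ∑_{d(x,y)^θ ≤ n ≤ 2D^θ} C / V(x, n^{1/θ})`. -/
theorem stmt6 (θ p0 CD CP Ccs1 Ccs2 ε : ℝ) (hθ : 2 ≤ θ) :
    ∃ C > (0 : ℝ),
      ∀ (V : Type) [Fintype V] [DecidableEq V],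
        ∀ (G : SimpleGraph V) (K : V → V → ℝ) (pi : V → ℝ),
          IsMarkovKernel G K pi → Harnack G K pi θ p0 CD CP Ccs1 Ccs2 ε → Lazy K →
          ∀ x y : V,
            |green K pi x y| ≤
              ∑ n ∈ Finset.Icc ⌈((G.dist x y : ℝ)) ^ θ⌉₊ ⌊2 * (gdiam G : ℝ) ^ θ⌋₊,
                C / vol G pi x ((n : ℝ) ^ (1 / θ)) := by
  refine ⟨max 1 (cF θ CD CP Ccs2), lt_of_lt_of_le one_pos (le_max_left _ _), ?_⟩
  intro V _ _ G K pi hM hH hL x y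
  have h := toHS hθ hM hH hL
  refine (h.final x y).trans ?_
  rw [Finset.mul_sum]
  apply Finset.sum_le_sum
  intro n _
  rw [mul_one_div]
  exact div_le_div_of_nonneg_right (le_max_right _ _)
    (h.vol_pos x (Real.rpow_nonneg (Nat.cast_nonneg n) _)).le
end
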